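/- Let 4/3<α≤6, let 2<q<∞ and let r be defined by 1/r+1/q=1/2 (so r=2q/(q−2)∈(2,∞)), and set γ:=(1−2/r)(1/2−α/4). There exists a constant C>0 depending only on α and q such that for every Schwartz function u₀∈𝒮(ℝ²), the function w(t,x,y) := ∫_{ℝ²} e^{i(xξ+yη)} |ξ|^{−γ} e^{it(ξ|ξ|^α − η²/ξ)} û₀(ξ,η) dξ dη (an absolutely convergent integral for each t) satisfies the mixed-norm Strichartz estimate ( ∫_ℝ ( ∫_{ℝ²} |w(t,x,y)|^r dx dy )^{q/r} dt )^{1/q} ≤ C·‖u₀‖_{L²(ℝ²)}. -/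

import Mathlib

open Real MeasureTheory Complex

lemma curvature_bound {u v k : ℝ} (hu : 1 ≤ u) (hk0 : 0 ≤ k) (hk1 : k ≤ 1) :
    (1 + |2 - k * v|) / (1 + ((2 + v) * u) ^ 2) ≤
      15 / u ^ 2 + 3 / 2 * ((2 - k * v) / (1 + ((2 + v) * u) ^ 2)) := by
  have hu0 : 0 < u := by linarith
  have hden : 0 < 1 + ((2 + v) * u) ^ 2 := by positivity
  rcases le_or_gt 1 |2 + v| with h | h
  · have hv : |v| ≤ 3 * |2 + v| := by
      have h1 : |v| ≤ |2 + v| + 2 := by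
        calc |v| = |(2 + v) - 2| := by ring_nf
          _ ≤ |2 + v| + |(2 : ℝ)| := abs_sub _ _
          _ = _ := by norm_num
      linarith
    have hy : |2 - k * v| ≤ 5 * |2 + v| := by
      calc |2 - k * v| ≤ |(2 : ℝ)| + |k * v| := abs_sub _ _
        _ ≤ 2 + |v| := by
          rw [abs_mul, abs_of_nonneg hk0]
          have := mul_le_of_le_one_left (abs_nonneg v) hk1
          norm_num; linarith
        _ ≤ _ := by linarith
    have h3 := neg_abs_le (2 - k * v)
    have key : (1 + |2 - k * v| - 3 / 2 * (2 - k * v)) / (1 + ((2 + v) * u) ^ 2) ≤ 15 / u ^ 2 := by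
      rw [div_le_div_iff₀ hden (by positivity)]
      have e : ((2 + v) * u) ^ 2 = |2 + v| ^ 2 * u ^ 2 := by rw [sq_abs]; ring
      rw [e]
      set w := |2 + v|
      have : 1 + |2 - k * v| - 3 / 2 * (2 - k * v) ≤ 15 * w ^ 2 := by nlinarith
      nlinarith [sq_nonneg u]
    have e2 : (1 + |2 - k * v| - 3 / 2 * (2 - k * v)) / (1 + ((2 + v) * u) ^ 2) =
      (1 + |2 - k * v|) / (1 + ((2 + v) * u) ^ 2) -
        3 / 2 * ((2 - k * v) / (1 + ((2 + v) * u) ^ 2)) := by ring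
    linarith
  · rw [abs_lt] at h
    have hy : 2 ≤ 2 - k * v := by nlinarith
    rw [abs_of_nonneg (by linarith)]
    have : (1 + (2 - k * v)) / (1 + ((2 + v) * u) ^ 2) ≤
        3 / 2 * ((2 - k * v) / (1 + ((2 + v) * u) ^ 2)) := by
      rw [← mul_div_assoc]
      gcongr
      linarith
    have : 0 ≤ 15 / u ^ 2 := by positivity
    linarith

lemma slope_bound {u v k : ℝ} (hu : 1 ≤ u) (hk0 : 0 ≤ k) :
    |(2 + v) * u| / (1 + ((2 + v) * u) ^ 2) / u ≤
      1 / u ^ 2 + 5 / 3 * ((1 + k) * |v| / (u * (1 + v ^ 2))) := by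
  have hu0 : 0 < u := by linarith
  have hden : 0 < 1 + ((2 + v) * u) ^ 2 := by positivity
  have hn : 0 ≤ 5 / 3 * ((1 + k) * |v| / (u * (1 + v ^ 2))) := by positivity
  rcases le_or_gt 1 |2 + v| with h | h
  · have : |(2 + v) * u| / (1 + ((2 + v) * u) ^ 2) / u ≤ 1 / u ^ 2 := by
      rw [div_div, div_le_div_iff₀ (by positivity) (by positivity), abs_mul, abs_of_pos hu0]
      have e : ((2 + v) * u) ^ 2 = |2 + v| ^ 2 * u ^ 2 := by rw [sq_abs]; ring
      rw [e]
      set w := |2 + v|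
      have : w ≤ w ^ 2 := by nlinarith
      have : w * (u ^ 3) ≤ w ^ 2 * u ^ 3 := by gcongr
      nlinarith
    linarith
  · rw [abs_lt] at h
    have h1 : |(2 + v) * u| / (1 + ((2 + v) * u) ^ 2) ≤ 1 / 2 := by
      rw [div_le_div_iff₀ hden (by norm_num)]
      nlinarith [sq_nonneg (|(2 + v) * u| - 1), sq_abs ((2 + v) * u)]
    have hv : |v| = -v := abs_of_neg (by linarith)
    have h2 : 3 / 10 ≤ |v| / (1 + v ^ 2) := by
      rw [le_div_iff₀ (by positivity), hv]
      nlinarith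
    have h3 : |(2 + v) * u| / (1 + ((2 + v) * u) ^ 2) / u ≤ 1 / 2 / u := by gcongr
    have h4 : 1 / 2 / u ≤ 5 / 3 * ((1 + k) * |v| / (u * (1 + v ^ 2))) := by
      have e : 5 / 3 * ((1 + k) * |v| / (u * (1 + v ^ 2))) =
        5 / 3 * ((1 + k) * (|v| / (1 + v ^ 2))) / u := by field_simp
      rw [e]
      gcongr
      nlinarith
    have : 0 ≤ 1 / u ^ 2 := by positivity
    linarith

lemma norm_oscillatory_integral_le_of_one_le {β σ b c p q : ℝ} (hβ0 : 0 < β) (hβ1 : β < 1)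
    (hc : 0 ≤ c) (hp : 1 ≤ p) (hpq : p ≤ q) :
    ‖∫ u in p..q, Complex.exp (I * ((σ * Real.log u + u ^ 2 + b * u ^ β : ℝ) : ℂ)
      - ((c * u ^ β : ℝ) : ℂ))‖ ≤ 25 * (1 + |σ|) := by
  set g : ℝ → ℂ := fun u => Complex.exp (I * ((σ * Real.log u + u ^ 2 + b * u ^ β : ℝ) : ℂ)
      - ((c * u ^ β : ℝ) : ℂ)) with hg
  set v : ℝ → ℝ := fun u => b * β * u ^ (β - 2) with hv
  set y : ℝ → ℝ := fun u => (2 + v u) * u with hy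
  set ρ : ℝ → ℝ := fun u => y u / (1 + y u ^ 2) with hρ
  have hgn : ∀ u, ‖g u‖ = Real.exp (-(c * u ^ β)) := by
    intro u
    simp only [hg, Complex.norm_exp]
    congr 1
    simp [-ofReal_add, -ofReal_mul]
  have hv' : ∀ u, 0 < u → HasDerivAt v ((β - 2) * v u / u) u := by
    intro u hu
    have := (Real.hasDerivAt_rpow_const (x := u) (p := β - 2) (Or.inl hu.ne')).const_mul (b * β)
    refine this.congr_deriv ?_
    rw [Real.rpow_sub_one hu.ne']
    simp only [hv]; ring
  have hy' : ∀ u, 0 < u → HasDerivAt y (2 - (1 - β) * v u) u := by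
    intro u hu
    have := ((hv' u hu).const_add 2).mul (hasDerivAt_id u)
    refine this.congr_deriv ?_
    simp only [id]
    field_simp
    ring
  have hden : ∀ u, 0 < 1 + y u ^ 2 := fun u => by positivity
  have hρ' : ∀ u, 0 < u → HasDerivAt ρ ((2 - (1 - β) * v u) * (1 - y u ^ 2) / (1 + y u ^ 2) ^ 2) u := by
    intro u hu
    have := (hy' u hu).div (((hy' u hu).pow 2).const_add 1) (hden u).ne'
    refine this.congr_deriv ?_
    simp only [Pi.pow_apply]
    congr 1
    push_cast
    ring
  have hpow : ∀ u, 0 < u → HasDerivAt (fun u : ℝ => u ^ β) (β * u ^ (β - 1)) u := fun u hu =>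
    Real.hasDerivAt_rpow_const (Or.inl hu.ne')
  have hvu : ∀ u, 0 < u → b * (β * u ^ (β - 1)) = v u * u := by
    intro u hu
    have : u ^ (β - 1) = u ^ (β - 2) * u := by
      rw [← Real.rpow_add_one hu.ne']; ring_nf
    simp only [hv, this]; ring
  have hg' : ∀ u, 0 < u → HasDerivAt g (g u * (I * ((σ / u + y u : ℝ) : ℂ)
      - ((c * (β * u ^ (β - 1)) : ℝ) : ℂ))) u := by
    intro u hu
    have h1 : HasDerivAt (fun u : ℝ => σ * Real.log u + u ^ 2 + b * u ^ β) (σ / u + y u) u := by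
      have := (((Real.hasDerivAt_log hu.ne').const_mul σ).add (hasDerivAt_pow 2 u)).add
        ((hpow u hu).const_mul b)
      refine this.congr_deriv ?_
      rw [hvu u hu]; simp only [hy]; push_cast; ring
    have h2 := (hpow u hu).const_mul c
    exact ((h1.ofReal_comp.const_mul I).sub h2.ofReal_comp).cexp
  have hgc : ContinuousOn g (Set.Ioi 0) := fun u hu => (hg' u hu).continuousAt.continuousWithinAt
  set F : ℝ → ℂ := fun x => I * (∫ u in p..x, g u) - (ρ x : ℂ) * g x with hF
  set F' : ℝ → ℂ := fun u => I * g u - ((((2 - (1 - β) * v u) * (1 - y u ^ 2) / (1 + y u ^ 2) ^ 2 : ℝ) : ℂ) * g u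
      + (ρ u : ℂ) * (g u * (I * ((σ / u + y u : ℝ) : ℂ) - ((c * (β * u ^ (β - 1)) : ℝ) : ℂ))))
    with hF'
  have hFd : ∀ x, p ≤ x → HasDerivAt F (F' x) x := by
    intro x hx
    have hx0 : 0 < x := by linarith
    have h1 : HasDerivAt (fun x => ∫ u in p..x, g u) (g x) x := by
      apply intervalIntegral.integral_hasDerivAt_right
      · apply ContinuousOn.intervalIntegrable
        apply hgc.mono
        rw [Set.uIcc_of_le hx]
        intro z hz
        exact lt_of_lt_of_le (by linarith) hz.1
      · exact hgc.stronglyMeasurableAtFilter isOpen_Ioi x hx0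
      · exact (hg' x hx0).continuousAt
    exact (h1.const_mul I).sub ((hρ' x hx0).ofReal_comp.mul (hg' x hx0))
  set M : ℝ → ℝ := fun u => -(15 + |σ|) * u⁻¹ + 3 / 2 * Real.arctan (y u)
    - 5 / 3 * |σ| * Real.arctan (|b| * β * u ^ (β - 2)) - 1 / 2 * Real.exp (-(c * u ^ β)) with hM
  set M' : ℝ → ℝ := fun u => 15 / u ^ 2 + 3 / 2 * ((2 - (1 - β) * v u) / (1 + y u ^ 2))
    + |σ| * (1 / u ^ 2 + 5 / 3 * ((1 + (1 - β)) * |v u| / (u * (1 + v u ^ 2))))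
    + 1 / 2 * (c * (β * u ^ (β - 1)) * Real.exp (-(c * u ^ β))) with hM'
  have habs : ∀ u, 0 < u → |v u| = |b| * β * u ^ (β - 2) := by
    intro u hu
    simp only [hv]
    rw [abs_mul, abs_mul, abs_of_pos hβ0, abs_of_pos (Real.rpow_pos_of_pos hu _)]
  have hMd : ∀ u, 0 < u → HasDerivAt M (M' u) u := by
    intro u hu
    have h1 := (hasDerivAt_inv hu.ne').const_mul (-(15 + |σ|))
    have h2 := ((hy' u hu).arctan).const_mul (3 / 2)
    have h3 : HasDerivAt (fun u : ℝ => |b| * β * u ^ (β - 2)) ((β - 2) * |v u| / u) u := by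
      have := (Real.hasDerivAt_rpow_const (x := u) (p := β - 2) (Or.inl hu.ne')).const_mul (|b| * β)
      refine this.congr_deriv ?_
      rw [Real.rpow_sub_one hu.ne', habs u hu]
      ring
    have h4 := h3.arctan.const_mul (5 / 3 * |σ|)
    have h5 := (((hpow u hu).const_mul c).neg.exp).const_mul (1 / 2)
    refine (((h1.add h2).sub h4).sub h5).congr_deriv ?_
    simp only [hM', ← habs u hu, sq_abs, Pi.neg_apply]
    field_simp
    ring
  have hρabs : ∀ u, |ρ u| ≤ 1 / 2 := by
    intro u
    simp only [hρ]
    rw [abs_div, abs_of_pos (hden u), div_le_div_iff₀ (hden u) (by norm_num)]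
    nlinarith [sq_nonneg (|y u| - 1), sq_abs (y u)]
  have hgle : ∀ u, 0 < u → ‖g u‖ ≤ 1 := by
    intro u hu
    rw [hgn]
    apply Real.exp_le_one_iff.2
    have := Real.rpow_nonneg hu.le β
    nlinarith
  have hbound : ∀ u, 1 ≤ u → ‖F' u‖ ≤ M' u := by
    intro u hu
    have hu0 : 0 < u := by linarith
    have e : F' u = g u * (((1 / (1 + y u ^ 2) : ℝ) : ℂ) * I
        - (((2 - (1 - β) * v u) * (1 - y u ^ 2) / (1 + y u ^ 2) ^ 2 : ℝ) : ℂ)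
        - ((ρ u * σ / u : ℝ) : ℂ) * I) + ((ρ u * (c * (β * u ^ (β - 1))) : ℝ) : ℂ) * g u := by
      have hr : (1 / (1 + y u ^ 2) : ℝ) = 1 - ρ u * y u := by
        simp only [hρ]
        field_simp
        ring
      rw [hr]
      simp only [hF']
      push_cast
      ring
    have n1 : |1 / (1 + y u ^ 2)| + |(2 - (1 - β) * v u) * (1 - y u ^ 2) / (1 + y u ^ 2) ^ 2| ≤
        (1 + |2 - (1 - β) * v u|) / (1 + y u ^ 2) := by
      rw [abs_of_pos (by positivity), abs_div, abs_mul, abs_of_pos (pow_pos (hden u) 2), add_div]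
      refine add_le_add_right ?_ _
      rw [div_le_div_iff₀ (pow_pos (hden u) 2) (hden u)]
      have : |1 - y u ^ 2| ≤ 1 + y u ^ 2 := by
        rw [abs_le]; constructor <;> nlinarith [sq_nonneg (y u)]
      calc _ ≤ |2 - (1 - β) * v u| * (1 + y u ^ 2) * (1 + y u ^ 2) := by gcongr
        _ = _ := by ring
    have n2 : |ρ u * σ / u| = |σ| * (|y u| / (1 + y u ^ 2) / u) := by
      simp only [hρ]
      rw [abs_div, abs_mul, abs_div, abs_of_pos (hden u), abs_of_pos hu0]
      ring
    have c1 := curvature_bound (v := v u) hu (sub_nonneg.2 hβ1.le) (by linarith : 1 - β ≤ 1)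
    have c2 := slope_bound (v := v u) hu (sub_nonneg.2 hβ1.le)
    have hpp : 0 ≤ c * (β * u ^ (β - 1)) := by
      have := Real.rpow_nonneg hu0.le (β - 1)
      positivity
    have n3 : ‖((ρ u * (c * (β * u ^ (β - 1))) : ℝ) : ℂ) * g u‖ ≤
        1 / 2 * (c * (β * u ^ (β - 1)) * Real.exp (-(c * u ^ β))) := by
      rw [norm_mul, hgn, Complex.norm_real, Real.norm_eq_abs, abs_mul, abs_of_nonneg hpp, mul_assoc]
      exact mul_le_mul_of_nonneg_right (hρabs u) (mul_nonneg hpp (Real.exp_pos _).le)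
    have n4 : ‖g u * (((1 / (1 + y u ^ 2) : ℝ) : ℂ) * I
        - (((2 - (1 - β) * v u) * (1 - y u ^ 2) / (1 + y u ^ 2) ^ 2 : ℝ) : ℂ)
        - ((ρ u * σ / u : ℝ) : ℂ) * I)‖ ≤ |1 / (1 + y u ^ 2)| +
          |(2 - (1 - β) * v u) * (1 - y u ^ 2) / (1 + y u ^ 2) ^ 2| + |ρ u * σ / u| := by
      rw [norm_mul]
      refine (mul_le_of_le_one_left (norm_nonneg _) (hgle u hu0)).trans ?_
      refine (norm_sub_le _ _).trans ?_
      gcongr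
      · refine (norm_sub_le _ _).trans ?_
        gcongr
        · rw [norm_mul, Complex.norm_real, Complex.norm_I, mul_one, Real.norm_eq_abs]
        · rw [Complex.norm_real, Real.norm_eq_abs]
      · rw [norm_mul, Complex.norm_real, Complex.norm_I, mul_one, Real.norm_eq_abs]
    rw [e]
    refine (norm_add_le _ _).trans ?_
    have c3 : |σ| * (|y u| / (1 + y u ^ 2) / u) ≤ |σ| * (1 / u ^ 2 + 5 / 3 * ((1 + (1 - β)) * |v u| / (u * (1 + v u ^ 2)))) :=
      mul_le_mul_of_nonneg_left c2 (abs_nonneg σ)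
    rw [← n2] at c3
    simp only [hM']
    linarith
  have hFp : ‖F p‖ ≤ M p - M p + 1 / 2 := by
    simp only [hF, intervalIntegral.integral_same, mul_zero, zero_sub, norm_neg, norm_mul,
      Complex.norm_real, Real.norm_eq_abs, sub_self, zero_add]
    exact (mul_le_of_le_one_right (abs_nonneg _) (hgle p (by linarith))).trans (hρabs p)
  have main := image_norm_le_of_norm_deriv_right_le_deriv_boundary' (a := p) (b := q)
    (fun x hx => (hFd x hx.1).continuousAt.continuousWithinAt)
    (fun x hx => (hFd x hx.1).hasDerivWithinAt) (B := fun x => M x - M p + 1 / 2) (B' := M') hFp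
    (fun x hx => (((hMd x (by linarith [hx.1])).sub_const (M p)).add_const
      (1 / 2)).continuousAt.continuousWithinAt)
    (fun x hx => (((hMd x (by linarith [hx.1])).sub_const (M p)).add_const
      (1 / 2)).hasDerivWithinAt)
    (fun x hx => hbound x (by linarith [hx.1])) (Set.right_mem_Icc.2 hpq)
  have hq0 : 0 < q := by linarith
  have hI : ‖∫ u in p..q, g u‖ ≤ ‖F q‖ + 1 / 2 := by
    have e : ∫ u in p..q, g u = -I * (F q + (ρ q : ℂ) * g q) := by
      simp only [hF, sub_add_cancel]
      rw [← mul_assoc]; simp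
    rw [e, norm_mul, norm_neg, Complex.norm_I, one_mul]
    refine (norm_add_le _ _).trans ?_
    gcongr
    rw [norm_mul, Complex.norm_real, Real.norm_eq_abs]
    exact (mul_le_of_le_one_right (abs_nonneg _) (hgle q hq0)).trans (hρabs q)
  have hMM : M q - M p ≤ 24 + 24 * |σ| := by
    have hp0 : 0 < p := by linarith
    have a1 : (0 : ℝ) ≤ q⁻¹ := by positivity
    have a2 : p⁻¹ ≤ 1 := inv_le_one_of_one_le₀ hp
    have a3 := Real.arctan_lt_pi_div_two (y q)
    have a4 := Real.neg_pi_div_two_lt_arctan (y p)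
    have a5 := Real.arctan_lt_pi_div_two (|b| * β * p ^ (β - 2))
    have a6 : 0 ≤ Real.arctan (|b| * β * q ^ (β - 2)) := by
      apply Real.arctan_nonneg.2
      have := Real.rpow_nonneg hq0.le (β - 2)
      positivity
    have a7 : Real.exp (-(c * p ^ β)) ≤ 1 := by rw [← hgn]; exact hgle p hp0
    have a8 := Real.exp_pos (-(c * q ^ β))
    have a9 := Real.pi_lt_d2
    have hs := abs_nonneg σ
    simp only [hM]
    have b1 : (15 + |σ|) * p⁻¹ ≤ 15 + |σ| := mul_le_of_le_one_right (by positivity) a2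
    have b2 : 0 ≤ (15 + |σ|) * q⁻¹ := by positivity
    have b3 : |σ| * Real.arctan (|b| * β * p ^ (β - 2)) ≤ |σ| * 1.6 := by
      gcongr; linarith
    have b4 : 0 ≤ |σ| * Real.arctan (|b| * β * q ^ (β - 2)) := by positivity
    linarith
  have hs := abs_nonneg σ
  change ‖∫ u in p..q, g u‖ ≤ _
  linarith

lemma norm_oscillatory_integral_le {β σ b c p q : ℝ} (hβ0 : 0 < β) (hβ1 : β < 1)
    (hc : 0 ≤ c) (hp : 0 < p) (hpq : p ≤ q) :
    ‖∫ u in p..q, Complex.exp (I * ((σ * Real.log u + u ^ 2 + b * u ^ β : ℝ) : ℂ)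
      - ((c * u ^ β : ℝ) : ℂ))‖ ≤ 26 * (1 + |σ|) := by
  set g : ℝ → ℂ := fun u => Complex.exp (I * ((σ * Real.log u + u ^ 2 + b * u ^ β : ℝ) : ℂ)
      - ((c * u ^ β : ℝ) : ℂ)) with hg
  have hs := abs_nonneg σ
  have hgle : ∀ u, 0 < u → ‖g u‖ ≤ 1 := by
    intro u hu
    have := Real.rpow_nonneg hu.le β
    simp only [hg, Complex.norm_exp]
    apply Real.exp_le_one_iff.2
    simp [-ofReal_add, -ofReal_mul]
    positivity
  have hgc : ContinuousOn g (Set.Ioi 0) := by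
    intro u hu
    have hu' : u ≠ 0 := ne_of_gt hu
    apply ContinuousAt.continuousWithinAt
    have h1 : ContinuousAt (fun u : ℝ => u ^ β) u := Real.continuousAt_rpow_const _ _ (Or.inl hu')
    have h2 := Real.continuousAt_log hu'
    simp only [hg]
    fun_prop
  have hint : ∀ a b : ℝ, 0 < a → a ≤ b → IntervalIntegrable g volume a b := by
    intro a b ha hab
    apply ContinuousOn.intervalIntegrable
    apply hgc.mono
    rw [Set.uIcc_of_le hab]
    exact fun z hz => lt_of_lt_of_le ha hz.1
  have hsmall : ∀ b : ℝ, p ≤ b → b ≤ 1 → ‖∫ u in p..b, g u‖ ≤ 1 := by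
    intro b hb hb1
    have := intervalIntegral.norm_integral_le_of_norm_le_const (a := p) (b := b) (f := g) (C := 1)
      (by
        intro x hx
        rw [Set.uIoc_of_le hb] at hx
        exact hgle x (hp.trans hx.1))
    refine this.trans ?_
    rw [one_mul, abs_of_nonneg (by linarith)]
    linarith
  rcases le_total q 1 with hq | hq
  · exact (hsmall q hpq hq).trans (by linarith)
  rcases le_total 1 p with h | h
  · exact (norm_oscillatory_integral_le_of_one_le hβ0 hβ1 hc h hpq).trans (by linarith)
  · have h1 := hsmall 1 h le_rfl
    have h2 := norm_oscillatory_integral_le_of_one_le (σ := σ) (b := b) hβ0 hβ1 hc le_rfl hq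
    rw [← intervalIntegral.integral_add_adjacent_intervals (hint p 1 hp h) (hint 1 q one_pos hq)]
    refine (norm_add_le _ _).trans ?_
    linarith

lemma norm_dispersive_integral_le_of_pos {α σ a c t ε R : ℝ} (hα : 1 < α) (ht : 0 < t)
    (hc : 0 ≤ c) (hε : 0 < ε) (hR : ε ≤ R) :
    ‖∫ ξ in ε..R, ((ξ ^ ((α - 1) / 2) : ℝ) : ℂ) *
      Complex.exp (I * ((σ * Real.log ξ + t * ξ ^ (α + 1) + a * ξ : ℝ) : ℂ)
      - ((c * ξ : ℝ) : ℂ))‖ ≤ 26 * (1 + |σ|) * t ^ (-(1 / 2) : ℝ) := by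
  set β : ℝ := 2 / (α + 1) with hβ
  have hα1 : 0 < α + 1 := by linarith
  have hβ0 : 0 < β := by positivity
  have hβ1 : β < 1 := by rw [hβ, div_lt_one hα1]; linarith
  have hβα : β * (α + 1) = 2 := by rw [hβ]; field_simp
  set c0 : ℝ := t ^ (-(β / 2)) with hc0
  have hc0p : 0 < c0 := Real.rpow_pos_of_pos ht _
  set g : ℝ → ℂ := fun ξ => ((ξ ^ ((α - 1) / 2) : ℝ) : ℂ) *
      Complex.exp (I * ((σ * Real.log ξ + t * ξ ^ (α + 1) + a * ξ : ℝ) : ℂ)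
      - ((c * ξ : ℝ) : ℂ)) with hg
  have hgc : ContinuousOn g (Set.Ioi 0) := by
    intro u hu
    have hu' : u ≠ 0 := ne_of_gt hu
    apply ContinuousAt.continuousWithinAt
    have h1 : ContinuousAt (fun u : ℝ => u ^ (α + 1)) u :=
      Real.continuousAt_rpow_const _ _ (Or.inl hu')
    have h3 : ContinuousAt (fun u : ℝ => u ^ ((α - 1) / 2)) u :=
      Real.continuousAt_rpow_const _ _ (Or.inl hu')
    have h2 := Real.continuousAt_log hu'
    simp only [hg]
    fun_prop
  set p : ℝ := (ε / c0) ^ (1 / β) with hp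
  set q : ℝ := (R / c0) ^ (1 / β) with hq
  have hp0 : 0 < p := Real.rpow_pos_of_pos (by positivity) _
  have hpq : p ≤ q := by
    apply Real.rpow_le_rpow (by positivity) _ (by positivity)
    gcongr
  have hfp : c0 * p ^ β = ε := by
    rw [hp, ← Real.rpow_mul (by positivity), one_div_mul_cancel hβ0.ne', Real.rpow_one]
    field_simp
  have hfq : c0 * q ^ β = R := by
    have : 0 < R := by linarith
    rw [hq, ← Real.rpow_mul (by positivity), one_div_mul_cancel hβ0.ne', Real.rpow_one]
    field_simp
  have hpos : ∀ u ∈ Set.uIcc p q, 0 < u := by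
    intro u hu
    rw [Set.uIcc_of_le hpq] at hu
    exact lt_of_lt_of_le hp0 hu.1
  have hd : ∀ u, 0 < u → HasDerivAt (fun u : ℝ => c0 * u ^ β) (c0 * (β * u ^ (β - 1))) u := fun u hu =>
    (Real.hasDerivAt_rpow_const (Or.inl hu.ne')).const_mul c0
  have hsub := intervalIntegral.integral_deriv_smul_comp'' (a := p) (b := q)
    (f := fun u : ℝ => c0 * u ^ β) (f' := fun u => c0 * (β * u ^ (β - 1))) (g := g)
    (fun u hu => (hd u (hpos u hu)).continuousAt.continuousWithinAt)
    (fun u hu => (hd u (hpos u (Set.Ioo_subset_Icc_self hu))).hasDerivWithinAt)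
    (by
      intro u hu
      apply ContinuousAt.continuousWithinAt
      have h1 : ContinuousAt (fun u : ℝ => u ^ (β - 1)) u :=
        Real.continuousAt_rpow_const _ _ (Or.inl (hpos u hu).ne')
      fun_prop)
    (by
      apply hgc.mono
      rintro _ ⟨u, hu, rfl⟩
      have := Real.rpow_pos_of_pos (hpos u hu) β
      exact mul_pos hc0p this)
  simp only [hfp, hfq] at hsub
  rw [← hsub]
  have hlogc : Real.log c0 = -(β / 2) * Real.log t := Real.log_rpow ht _
  have key : ∀ u, 0 < u → (c0 * (β * u ^ (β - 1))) • (g ∘ fun u : ℝ => c0 * u ^ β) u =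
      (((t ^ (-(1 / 2) : ℝ) * β : ℝ) : ℂ) * Complex.exp (I * ((σ * Real.log c0 : ℝ) : ℂ))) *
      Complex.exp (I * (((σ * β) * Real.log u + u ^ 2 + (a * c0) * u ^ β : ℝ) : ℂ)
      - (((c * c0) * u ^ β : ℝ) : ℂ)) := by
    intro u hu
    have e1 : c0 * (β * u ^ (β - 1)) * (c0 * u ^ β) ^ ((α - 1) / 2) = t ^ (-(1 / 2) : ℝ) * β := by
      have hub := Real.rpow_pos_of_pos hu β
      have hub1 := Real.rpow_pos_of_pos hu (β - 1)
      have : c0 * u ^ (β - 1) * (c0 * u ^ β) ^ ((α - 1) / 2) = t ^ (-(1 / 2) : ℝ) := by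
        apply Real.log_injOn_pos
        · exact mul_pos (mul_pos hc0p hub1) (Real.rpow_pos_of_pos (mul_pos hc0p hub) _)
        · exact Real.rpow_pos_of_pos ht _
        rw [Real.log_mul (by positivity) (by positivity), Real.log_mul (by positivity) (by positivity),
          Real.log_rpow (mul_pos hc0p hub), Real.log_mul (by positivity) (by positivity),
          Real.log_rpow hu, Real.log_rpow hu, Real.log_rpow ht (-(1 / 2)), hlogc]
        linear_combination (-Real.log t / 4 + Real.log u / 2) * hβα
      linear_combination β * this
    have e2 : Real.log (c0 * u ^ β) = Real.log c0 + β * Real.log u := by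
      rw [Real.log_mul (by positivity) (Real.rpow_pos_of_pos hu _).ne', Real.log_rpow hu]
    have e3 : t * (c0 * u ^ β) ^ (α + 1) = u ^ 2 := by
      rw [Real.mul_rpow hc0p.le (Real.rpow_nonneg hu.le _), ← Real.rpow_mul hu.le, hβα, hc0,
        ← Real.rpow_mul ht.le, show -(β / 2) * (α + 1) = -1 by linarith, Real.rpow_neg_one,
        ← mul_assoc, mul_inv_cancel₀ ht.ne', one_mul, Real.rpow_two]
    simp only [Function.comp, hg]
    rw [Complex.real_smul, ← mul_assoc, ← ofReal_mul, e1, e2, e3, mul_assoc (_ : ℂ) (Complex.exp _),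
      ← Complex.exp_add]
    congr 2
    push_cast
    ring
  rw [intervalIntegral.integral_congr (fun u hu => key u (hpos u hu)),
    intervalIntegral.integral_const_mul, norm_mul, norm_mul, mul_comm I, Complex.norm_exp_ofReal_mul_I,
    Complex.norm_real, Real.norm_eq_abs, mul_one]
  have htp := Real.rpow_pos_of_pos ht (-(1 / 2))
  rw [abs_of_pos (by positivity)]
  have main := norm_oscillatory_integral_le (σ := σ * β) (b := a * c0) (c := c * c0) hβ0 hβ1
    (by positivity) hp0 hpq
  have hσ : |σ * β| ≤ |σ| := by
    rw [abs_mul, abs_of_pos hβ0]; exact mul_le_of_le_one_right (abs_nonneg _) hβ1.le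
  calc _ ≤ t ^ (-(1 / 2) : ℝ) * 1 * (26 * (1 + |σ|)) := by
        gcongr
        exact main.trans (by linarith)
    _ = _ := by ring

lemma norm_dispersive_integral_le {α σ a c t ε R : ℝ} (hα : 1 < α) (ht : t ≠ 0)
    (hc : 0 ≤ c) (hε : 0 < ε) (hR : ε ≤ R) :
    ‖∫ ξ in ε..R, ((ξ ^ ((α - 1) / 2) : ℝ) : ℂ) *
      Complex.exp (I * ((σ * Real.log ξ + t * ξ ^ (α + 1) + a * ξ : ℝ) : ℂ)
      - ((c * ξ : ℝ) : ℂ))‖ ≤ 26 * (1 + |σ|) * |t| ^ (-(1 / 2) : ℝ) := by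
  rcases lt_or_gt_of_ne ht with h | h
  · have := norm_dispersive_integral_le_of_pos (σ := -σ) (a := -a) hα (neg_pos.2 h) hc hε hR
    rw [abs_neg] at this
    rw [abs_of_neg h]
    refine le_trans (le_of_eq ?_) this
    rw [← Complex.norm_conj, intervalIntegral.integral_of_le hR, intervalIntegral.integral_of_le hR,
      ← integral_conj]
    congr 2
    ext ξ
    rw [map_mul, Complex.conj_ofReal, ← Complex.exp_conj, map_sub, map_mul, Complex.conj_I,
      Complex.conj_ofReal, Complex.conj_ofReal]
    congr 3
    push_cast
    ring
  · rw [abs_of_pos h]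
    exact norm_dispersive_integral_le_of_pos hα h hc hε hR

/-- The phase function of the dispersion-generalised KP-II group. -/
noncomputable def kpPhase (α : ℝ) (p : ℝ × ℝ) : ℝ := p.1 * |p.1| ^ α - p.2 ^ 2 / p.1

/-- The pairing between positions and frequencies in the plane. -/
def planePairing (x p : ℝ × ℝ) : ℝ := x.1 * p.1 + x.2 * p.2

/-- The symbol `|ξ|^{-κz}`, truncated to `ε < |ξ| < R` and damped by `exp (-δη²/|ξ|)`. -/
noncomputable def truncatedSymbol (κ ε R δ : ℝ) (z : ℂ) (p : ℝ × ℝ) : ℂ :=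
  if ε < |p.1| ∧ |p.1| < R then
    Complex.exp (z * ((-κ * Real.log |p.1| : ℝ) : ℂ)) * ((Real.exp (-(δ * (p.2 ^ 2 / |p.1|))) : ℝ) : ℂ)
  else 0

lemma measurable_kpPhase (α : ℝ) : Measurable (kpPhase α) := by
  unfold kpPhase
  fun_prop

lemma measurable_planePairing : Measurable (fun q : (ℝ × ℝ) × (ℝ × ℝ) => planePairing q.1 q.2) := by
  unfold planePairing
  fun_prop

lemma measurableSet_truncation (ε R : ℝ) :
    MeasurableSet {p : ℝ × ℝ | ε < |p.1| ∧ |p.1| < R} := by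
  have h : Measurable (fun p : ℝ × ℝ => |p.1|) := by fun_prop
  exact (measurableSet_lt measurable_const h).inter (measurableSet_lt h measurable_const)

lemma measurable_truncatedSymbol (κ ε R δ : ℝ) (z : ℂ) :
    Measurable (truncatedSymbol κ ε R δ z) := by
  unfold truncatedSymbol
  refine Measurable.ite (measurableSet_truncation ε R) ?_ measurable_const
  have h1 : Measurable (fun p : ℝ × ℝ => Real.log |p.1|) := by fun_prop
  fun_prop

lemma kpPhase_neg (α : ℝ) (p : ℝ × ℝ) : kpPhase α (-p) = -kpPhase α p := by
  simp only [kpPhase, Prod.fst_neg, Prod.snd_neg, abs_neg, neg_sq, div_neg]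
  ring

lemma abs_log_le_of_mem {ε R ξ : ℝ} (hε : 0 < ε) (h1 : ε < |ξ|) (h2 : |ξ| < R) :
    |Real.log (|ξ|)| ≤ |Real.log ε| + |Real.log R| := by
  have h0 : 0 < |ξ| := hε.trans h1
  have a1 := Real.log_le_log hε h1.le
  have a2 := Real.log_le_log h0 h2.le
  rw [abs_le]
  constructor
  · have := neg_abs_le (Real.log ε); have := abs_nonneg (Real.log R); linarith
  · have := le_abs_self (Real.log R); have := abs_nonneg (Real.log ε); linarith

lemma norm_truncatedSymbol (κ ε R δ : ℝ) (z : ℂ) (p : ℝ × ℝ) :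
    ‖truncatedSymbol κ ε R δ z p‖ = if ε < |p.1| ∧ |p.1| < R then
      Real.exp (-(κ * z.re) * Real.log |p.1|) * Real.exp (-(δ * (p.2 ^ 2 / |p.1|))) else 0 := by
  unfold truncatedSymbol
  split_ifs with h
  · rw [norm_mul, Complex.norm_real, Real.norm_eq_abs, abs_of_pos (Real.exp_pos _), Complex.norm_exp,
      Complex.re_mul_ofReal]
    congr 2
    ring
  · simp

lemma integrable_truncatedSymbol {κ ε R δ : ℝ} (hε : 0 < ε) (hδ : 0 < δ) (z : ℂ) :
    Integrable (truncatedSymbol κ ε R δ z) := by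
  rcases le_or_gt R 0 with hR | hR
  · have : truncatedSymbol κ ε R δ z = 0 := by
      ext p
      unfold truncatedSymbol
      rw [if_neg]
      · rfl
      · rintro ⟨-, h⟩
        have := abs_nonneg p.1
        linarith
    rw [this]; exact integrable_zero _ _ _
  set L := |Real.log ε| + |Real.log R|
  have hG : Integrable (fun η : ℝ => Real.exp (-(δ / R) * η ^ 2)) :=
    integrable_exp_neg_mul_sq (by positivity)
  have hI : Integrable (Set.indicator (Set.Ioo (-R) R) (fun _ : ℝ => Real.exp (|κ * z.re| * L))) := by
    rw [integrable_indicator_iff measurableSet_Ioo]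
    exact integrableOn_const (by simp)
  have := hI.mul_prod hG
  refine this.mono' (measurable_truncatedSymbol κ ε R δ z).aestronglyMeasurable (ae_of_all _ fun p => ?_)
  rw [norm_truncatedSymbol]
  split_ifs with h
  · have hmem : p.1 ∈ Set.Ioo (-R) R := abs_lt.1 h.2
    rw [Set.indicator_of_mem hmem]
    have h0 : 0 < |p.1| := hε.trans h.1
    refine mul_le_mul (Real.exp_le_exp.2 ?_) (Real.exp_le_exp.2 ?_) (Real.exp_pos _).le
      (Real.exp_pos _).le
    · refine (le_abs_self _).trans ?_
      rw [abs_mul, abs_neg]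
      gcongr
      exact abs_log_le_of_mem hε h.1 h.2
    · rw [neg_mul, neg_le_neg_iff, div_mul_eq_mul_div, mul_div_assoc]
      gcongr
      exact h.2.le
  · apply mul_nonneg
    · exact Set.indicator_nonneg (fun _ _ => (Real.exp_pos _).le) _
    · exact (Real.exp_pos _).le

lemma gaussian_slice {δ t y ξ : ℝ} (hδ : 0 < δ) (hξ : 0 < ξ) :
    ∫ η : ℝ, Complex.exp (-I * ((y * η - t * (η ^ 2 / ξ) : ℝ) : ℂ)) *
        ((Real.exp (-(δ * (η ^ 2 / ξ))) : ℝ) : ℂ) =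
      (π / ((δ : ℂ) - I * t)) ^ (1 / 2 : ℂ) * ((ξ ^ (1 / 2 : ℝ) : ℝ) : ℂ) *
        Complex.exp (I * ((-(y ^ 2 * t / (4 * (δ ^ 2 + t ^ 2))) * ξ : ℝ) : ℂ) -
          ((y ^ 2 * δ / (4 * (δ ^ 2 + t ^ 2)) * ξ : ℝ) : ℂ)) := by
  have hξc : (ξ : ℂ) ≠ 0 := by exact_mod_cast hξ.ne'
  set b : ℂ := ((δ : ℂ) - I * t) / ξ with hb
  have hre : ((δ : ℂ) - I * t).re = δ := by simp
  have hne : (δ : ℂ) - I * t ≠ 0 := by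
    intro h; rw [h] at hre; simp at hre; linarith
  have hbre : 0 < b.re := by
    rw [hb, Complex.div_ofReal_re, hre]; positivity
  have h := fourierIntegral_gaussian hbre (-y : ℂ)
  have e1 : ∀ η : ℝ, Complex.exp (-I * ((y * η - t * (η ^ 2 / ξ) : ℝ) : ℂ)) *
        ((Real.exp (-(δ * (η ^ 2 / ξ))) : ℝ) : ℂ) =
      Complex.exp (I * (-y : ℂ) * η) * Complex.exp (-b * (η : ℂ) ^ 2) := by
    intro η
    rw [Complex.ofReal_exp, ← Complex.exp_add, ← Complex.exp_add]
    congr 1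
    rw [hb]
    push_cast
    field_simp
    ring
  simp_rw [e1]
  rw [h]
  have e2 : (π / b : ℂ) = (ξ : ℂ) * (π / ((δ : ℂ) - I * t)) := by
    rw [hb]; field_simp
  have hw : (π / ((δ : ℂ) - I * t)) ≠ 0 := div_ne_zero (by exact_mod_cast Real.pi_pos.ne') hne
  have e3 : (π / b : ℂ) ^ (1 / 2 : ℂ) =
      (π / ((δ : ℂ) - I * t)) ^ (1 / 2 : ℂ) * ((ξ ^ (1 / 2 : ℝ) : ℝ) : ℂ) := by
    rw [e2, Complex.cpow_def_of_ne_zero (mul_ne_zero hξc hw), Complex.log_ofReal_mul hξ hw,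
      Complex.cpow_def_of_ne_zero hw, Complex.ofReal_cpow hξ.le, Complex.cpow_def_of_ne_zero hξc,
      ← Complex.exp_add, Complex.ofReal_log hξ.le]
    congr 1
    push_cast
    ring
  rw [e3]
  congr 2
  have hne2 : (δ : ℂ) + I * t ≠ 0 := by
    intro h
    have : ((δ : ℂ) + I * t).re = δ := by simp
    rw [h] at this; simp at this; linarith
  have hsq : ((δ : ℂ) ^ 2 + (t : ℂ) ^ 2) = ((δ : ℂ) - I * t) * ((δ : ℂ) + I * t) := by
    ring_nf
    rw [I_sq]; ring
  rw [hb]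
  push_cast
  rw [hsq]
  field_simp
  ring

lemma truncatedSymbol_slice {α ε R δ s t : ℝ} {x : ℝ × ℝ} {ξ : ℝ} (hε : 0 < ε) (hδ : 0 < δ)
    (hξ : ξ ∈ Set.Ioo ε R) :
    ∫ η : ℝ, truncatedSymbol (1 - α / 2) ε R δ (1 + s * I) (ξ, η) *
        Complex.exp (-I * ((planePairing x (ξ, η) + t * kpPhase α (ξ, η) : ℝ) : ℂ)) =
      (π / ((δ : ℂ) - I * t)) ^ (1 / 2 : ℂ) * (((ξ ^ ((α - 1) / 2) : ℝ) : ℂ) *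
      Complex.exp (I * ((-((1 - α / 2) * s) * Real.log ξ + (-t) * ξ ^ (α + 1) +
        (-(x.2 ^ 2 * t / (4 * (δ ^ 2 + t ^ 2))) - x.1) * ξ : ℝ) : ℂ)
      - ((x.2 ^ 2 * δ / (4 * (δ ^ 2 + t ^ 2)) * ξ : ℝ) : ℂ))) := by
  have hξ0 : 0 < ξ := hε.trans hξ.1
  have e1 : ∀ η : ℝ, truncatedSymbol (1 - α / 2) ε R δ (1 + s * I) (ξ, η) *
        Complex.exp (-I * ((planePairing x (ξ, η) + t * kpPhase α (ξ, η) : ℝ) : ℂ)) =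
      Complex.exp ((1 + s * I) * ((-(1 - α / 2) * Real.log ξ : ℝ) : ℂ) -
        I * ((x.1 * ξ + t * ξ ^ (α + 1) : ℝ) : ℂ)) *
      (Complex.exp (-I * ((x.2 * η - t * (η ^ 2 / ξ) : ℝ) : ℂ)) *
        ((Real.exp (-(δ * (η ^ 2 / ξ))) : ℝ) : ℂ)) := by
    intro η
    unfold truncatedSymbol planePairing kpPhase
    simp only [abs_of_pos hξ0]
    rw [if_pos ⟨hξ.1, hξ.2⟩]
    have e2 : ξ * ξ ^ α = ξ ^ (α + 1) := by rw [Real.rpow_add_one hξ0.ne', mul_comm]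
    rw [e2, ← mul_assoc, ← Complex.exp_add, mul_right_comm, ← Complex.exp_add]
    congr 2
    push_cast
    ring
  simp_rw [e1]
  rw [integral_const_mul, gaussian_slice hδ hξ0]
  have hp : ∀ k : ℝ, ((ξ ^ k : ℝ) : ℂ) = Complex.exp ((Real.log ξ * k : ℝ) : ℂ) := by
    intro k
    rw [Real.rpow_def_of_pos hξ0, Complex.ofReal_exp]
  rw [hp (1 / 2), hp ((α - 1) / 2)]
  have h3 : ∀ A L K B D E : ℂ, A + L + B = K + D - E → ∀ c : ℂ,
      Complex.exp A * (c * Complex.exp L * Complex.exp B) =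
        c * (Complex.exp K * Complex.exp (D - E)) := by
    intro A L K B D E h c
    rw [← Complex.exp_add, ← add_sub_assoc, ← h, Complex.exp_add, Complex.exp_add]
    ring
  apply h3
  push_cast
  ring

lemma norm_half_kernel_le {α ε R δ s t : ℝ} {x : ℝ × ℝ} (hα : 1 < α) (hε : 0 < ε) (hR : ε ≤ R)
    (hδ : 0 < δ) (ht : t ≠ 0) :
    ‖∫ ξ in Set.Ioo ε R, ∫ η : ℝ, truncatedSymbol (1 - α / 2) ε R δ (1 + s * I) (ξ, η) *
        Complex.exp (-I * ((planePairing x (ξ, η) + t * kpPhase α (ξ, η) : ℝ) : ℂ))‖ ≤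
      π ^ (1 / 2 : ℝ) * 26 * (1 + |(1 - α / 2) * s|) * |t|⁻¹ := by
  rw [setIntegral_congr_fun measurableSet_Ioo (fun ξ hξ => truncatedSymbol_slice hε hδ hξ),
    integral_const_mul, ← integral_Ioc_eq_integral_Ioo, ← intervalIntegral.integral_of_le hR, norm_mul]
  have hta : 0 < |t| := abs_pos.2 ht
  have h1 : ‖(π / ((δ : ℂ) - I * t)) ^ (1 / 2 : ℂ)‖ ≤ π ^ (1 / 2 : ℝ) * |t| ^ (-(1 / 2) : ℝ) := by
    have : (1 / 2 : ℂ) = ((1 / 2 : ℝ) : ℂ) := by push_cast; rfl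
    rw [this, Complex.norm_cpow_real, Real.rpow_neg hta.le, ← div_eq_mul_inv,
      ← Real.div_rpow Real.pi_pos.le hta.le, norm_div, Complex.norm_real, Real.norm_eq_abs,
      abs_of_pos Real.pi_pos]
    gcongr
    calc |t| = |((δ : ℂ) - I * t).im| := by simp
      _ ≤ _ := Complex.abs_im_le_norm _
  have h2 := norm_dispersive_integral_le (σ := -((1 - α / 2) * s))
    (a := -(x.2 ^ 2 * t / (4 * (δ ^ 2 + t ^ 2))) - x.1)
    (c := x.2 ^ 2 * δ / (4 * (δ ^ 2 + t ^ 2))) hα (neg_ne_zero.2 ht) (by positivity) hε hR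
  rw [abs_neg, abs_neg] at h2
  calc _ ≤ (π ^ (1 / 2 : ℝ) * |t| ^ (-(1 / 2) : ℝ)) *
        (26 * (1 + |(1 - α / 2) * s|) * |t| ^ (-(1 / 2) : ℝ)) := by gcongr
    _ = π ^ (1 / 2 : ℝ) * 26 * (1 + |(1 - α / 2) * s|) *
        (|t| ^ (-(1 / 2) : ℝ) * |t| ^ (-(1 / 2) : ℝ)) := by ring
    _ = _ := by
      rw [← Real.rpow_add hta]; norm_num [Real.rpow_neg_one]

lemma norm_exp_neg_I_mul (a : ℝ) : ‖Complex.exp (-I * (a : ℂ))‖ = 1 := by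
  rw [neg_mul, ← mul_neg, ← ofReal_neg, mul_comm, Complex.norm_exp_ofReal_mul_I]

lemma integrable_truncatedSymbol_mul_exp {κ ε R δ : ℝ} (hε : 0 < ε) (hδ : 0 < δ) (z : ℂ)
    {ψ : ℝ × ℝ → ℝ} (hψ : Measurable ψ) :
    Integrable (fun p => truncatedSymbol κ ε R δ z p * Complex.exp (-I * (ψ p : ℂ))) := by
  refine (integrable_truncatedSymbol hε hδ z).mul_bdd (c := 1) ?_ ?_
  · apply Measurable.aestronglyMeasurable
    fun_prop
  · exact ae_of_all _ fun p => (norm_exp_neg_I_mul _).le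

lemma norm_kernel_le {α ε R δ s t : ℝ} {x : ℝ × ℝ} (hα : 1 < α) (hε : 0 < ε) (hR : ε ≤ R)
    (hδ : 0 < δ) (ht : t ≠ 0) :
    ‖∫ p, truncatedSymbol (1 - α / 2) ε R δ (1 + s * I) p *
        Complex.exp (-I * ((planePairing x p + t * kpPhase α p : ℝ) : ℂ))‖ ≤
      52 * π ^ (1 / 2 : ℝ) * (1 + |(1 - α / 2) * s|) * |t|⁻¹ := by
  set f : ℝ → ℝ × ℝ → ℝ × ℝ → ℂ := fun t x p => truncatedSymbol (1 - α / 2) ε R δ (1 + s * I) p *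
        Complex.exp (-I * ((planePairing x p + t * kpPhase α p : ℝ) : ℂ)) with hf
  have hint : Integrable (f t x) := by
    apply integrable_truncatedSymbol_mul_exp hε hδ
    have := measurable_kpPhase α
    unfold planePairing
    fun_prop
  set G : ℝ → ℝ → ℝ × ℝ → ℂ := fun ξ t x => ∫ η, f t x (ξ, η) with hG
  have hGi : Integrable (fun ξ => G ξ t x) := hint.integral_prod_left
  have hneg : ∀ ξ, G (-ξ) t x = G ξ (-t) (-x) := by
    intro ξ
    simp only [hG]
    rw [← integral_neg_eq_self]
    congr 1
    ext η
    have h1 : ((-ξ, -η) : ℝ × ℝ) = -(ξ, η) := rfl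
    simp only [hf, h1, kpPhase_neg]
    congr 1
    · simp [truncatedSymbol]
    · congr 3
      simp only [planePairing, Prod.fst_neg, Prod.snd_neg]
      ring
  have hsplit : ∀ ξ, G ξ t x = (Set.Ioo ε R).indicator (fun ξ => G ξ t x) ξ +
      (Set.Ioo ε R).indicator (fun ξ => G ξ (-t) (-x)) (-ξ) := by
    intro ξ
    by_cases h1 : ξ ∈ Set.Ioo ε R
    · have h2 : -ξ ∉ Set.Ioo ε R := fun h => by linarith [h.1, h1.1]
      rw [Set.indicator_of_mem h1, Set.indicator_of_notMem h2, add_zero]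
    · by_cases h2 : -ξ ∈ Set.Ioo ε R
      · rw [Set.indicator_of_mem h2, Set.indicator_of_notMem h1, zero_add, ← hneg, neg_neg]
      · rw [Set.indicator_of_notMem h1, Set.indicator_of_notMem h2, zero_add]
        have h3 : ¬ (ε < |ξ| ∧ |ξ| < R) := by
          rintro ⟨a, b⟩
          rcases abs_cases ξ with ⟨h, _⟩ | ⟨h, _⟩
          · exact h1 ⟨h ▸ a, h ▸ b⟩
          · exact h2 ⟨h ▸ a, h ▸ b⟩
        simp only [hG, hf, truncatedSymbol, if_neg h3, zero_mul, integral_zero]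
  have hGi2 : Integrable (fun ξ => G ξ (-t) (-x)) := by
    have := hGi.comp_neg
    simpa only [hneg] using this
  calc ‖∫ p, f t x p‖ = ‖∫ ξ, G ξ t x‖ := by
        rw [Measure.volume_eq_prod, integral_prod _ (by rwa [← Measure.volume_eq_prod])]
    _ = ‖(∫ ξ in Set.Ioo ε R, G ξ t x) + ∫ ξ in Set.Ioo ε R, G ξ (-t) (-x)‖ := by
        rw [integral_congr_ae (ae_of_all _ hsplit), integral_add (hGi.indicator measurableSet_Ioo)
          (hGi2.indicator measurableSet_Ioo).comp_neg, integral_neg_eq_self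
            ((Set.Ioo ε R).indicator (fun ξ => G ξ (-t) (-x))),
          integral_indicator measurableSet_Ioo, integral_indicator measurableSet_Ioo]
    _ ≤ π ^ (1 / 2 : ℝ) * 26 * (1 + |(1 - α / 2) * s|) * |t|⁻¹ +
        π ^ (1 / 2 : ℝ) * 26 * (1 + |(1 - α / 2) * s|) * |-t|⁻¹ :=
        (norm_add_le _ _).trans (add_le_add (norm_half_kernel_le hα hε hR hδ ht)
          (norm_half_kernel_le hα hε hR hδ (neg_ne_zero.2 ht)))
    _ = _ := by rw [abs_neg]; ring

section Fubini

variable {Y P : Type*} [MeasurableSpace Y] [MeasurableSpace P] {ν : Measure Y} {μ : Measure P}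
  {k : P → ℂ} {a b : Y → P → ℂ} {A B : Y → ℝ}

lemma integrable_mul_bilinear (hk : Integrable k μ) (ha : Measurable (Function.uncurry a))
    (hb : Measurable (Function.uncurry b)) (hA : Integrable A ν) (hB : Integrable B ν)
    (haA : ∀ y p, ‖a y p‖ ≤ A y) (hbB : ∀ y p, ‖b y p‖ ≤ B y) :
    Integrable (fun w : (Y × Y) × P => k w.2 * (a w.1.1 w.2 * b w.1.2 w.2))
      ((ν.prod ν).prod μ) := by
  have h := (hA.mul_prod hB).mul_prod hk.norm
  refine h.mono' ?_ (ae_of_all _ fun w => ?_)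
  · have h1 : Measurable fun w : (Y × Y) × P => a w.1.1 w.2 * b w.1.2 w.2 := by
      have e1 : Measurable fun w : (Y × Y) × P => a w.1.1 w.2 :=
        ha.comp (f := fun w : (Y × Y) × P => (w.1.1, w.2)) (by fun_prop)
      have e2 : Measurable fun w : (Y × Y) × P => b w.1.2 w.2 :=
        hb.comp (f := fun w : (Y × Y) × P => (w.1.2, w.2)) (by fun_prop)
      exact e1.mul e2
    exact hk.1.comp_snd.mul h1.aestronglyMeasurable
  · rw [norm_mul, norm_mul, mul_comm]
    gcongr
    · exact (norm_nonneg _).trans (haA _ w.2)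
    · exact haA _ _
    · exact hbB _ _

lemma integral_mul_bilinear [SFinite ν] [SFinite μ] (hk : Integrable k μ) (ha : Measurable (Function.uncurry a))
    (hb : Measurable (Function.uncurry b)) (hA : Integrable A ν) (hB : Integrable B ν)
    (haA : ∀ y p, ‖a y p‖ ≤ A y) (hbB : ∀ y p, ‖b y p‖ ≤ B y) :
    ∫ p, k p * ((∫ y, a y p ∂ν) * ∫ y, b y p ∂ν) ∂μ =
      ∫ w : Y × Y, ∫ p, k p * (a w.1 p * b w.2 p) ∂μ ∂(ν.prod ν) := by
  rw [integral_integral_swap (integrable_mul_bilinear hk ha hb hA hB haA hbB)]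
  congr 1
  ext p
  rw [integral_const_mul, integral_prod_mul (fun y => a y p) (fun y => b y p)]

end Fubini

/-- The (non-normalised) Fourier transform on the plane. -/
noncomputable def planeFourier (f : ℝ × ℝ → ℂ) (p : ℝ × ℝ) : ℂ :=
  ∫ x, Complex.exp (-I * (planePairing x p : ℂ)) * f x

lemma measurable_uncurry_planeExp {f : ℝ × ℝ → ℂ} (hf : Measurable f) :
    Measurable (Function.uncurry fun x p : ℝ × ℝ => Complex.exp (-I * (planePairing x p : ℂ)) * f x) := by
  have := measurable_planePairing
  unfold Function.uncurry
  fun_prop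

lemma norm_planeExp (f : ℝ × ℝ → ℂ) (x p : ℝ × ℝ) :
    ‖Complex.exp (-I * (planePairing x p : ℂ)) * f x‖ = ‖f x‖ := by
  rw [norm_mul, norm_exp_neg_I_mul, one_mul]

lemma measurable_planeFourier {f : ℝ × ℝ → ℂ} (hf : Measurable f) : Measurable (planeFourier f) := by
  have h2 : Measurable (fun w : (ℝ × ℝ) × (ℝ × ℝ) =>
      Complex.exp (-I * (planePairing w.2 w.1 : ℂ)) * f w.2) := by
    unfold planePairing
    fun_prop
  have h3 : StronglyMeasurable (fun p : ℝ × ℝ =>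
      ∫ x, Complex.exp (-I * (planePairing x p : ℂ)) * f x) :=
    StronglyMeasurable.integral_prod_right (ν := volume) (f := fun p x : ℝ × ℝ =>
      Complex.exp (-I * (planePairing x p : ℂ)) * f x) h2.stronglyMeasurable
  exact h3.measurable

lemma norm_planeFourier_le (f : ℝ × ℝ → ℂ) (p : ℝ × ℝ) : ‖planeFourier f p‖ ≤ ∫ x, ‖f x‖ := by
  refine (norm_integral_le_integral_norm _).trans_eq ?_
  simp_rw [norm_planeExp]

lemma conj_planeExp (f : ℝ × ℝ → ℂ) (x p : ℝ × ℝ) :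
    (starRingEnd ℂ) (Complex.exp (-I * (planePairing x p : ℂ)) * f x) =
      Complex.exp (-I * (planePairing x (-p) : ℂ)) * (starRingEnd ℂ) (f x) := by
  rw [map_mul, ← Complex.exp_conj]
  congr 2
  simp [planePairing]
  ring

lemma conj_planeFourier (f : ℝ × ℝ → ℂ) (p : ℝ × ℝ) :
    (starRingEnd ℂ) (planeFourier f p) = planeFourier (fun x => (starRingEnd ℂ) (f x)) (-p) := by
  unfold planeFourier
  rw [← integral_conj]
  simp_rw [conj_planeExp]

lemma integral_gaussian_plane {δ : ℝ} (hδ : 0 < δ) (x : ℝ × ℝ) :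
    ∫ p : ℝ × ℝ, ((Real.exp (-δ * (p.1 ^ 2 + p.2 ^ 2)) : ℝ) : ℂ) *
      Complex.exp (-I * (planePairing x p : ℂ)) =
      ((π / δ * Real.exp (-(1 / (4 * δ)) * (x.1 ^ 2 + x.2 ^ 2)) : ℝ) : ℂ) := by
  have hre : 0 < (δ : ℂ).re := by simpa
  have e1 : ∀ p : ℝ × ℝ, ((Real.exp (-δ * (p.1 ^ 2 + p.2 ^ 2)) : ℝ) : ℂ) *
      Complex.exp (-I * (planePairing x p : ℂ)) =
      (Complex.exp (I * (-x.1 : ℂ) * p.1) * Complex.exp (-δ * (p.1 : ℂ) ^ 2)) *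
      (Complex.exp (I * (-x.2 : ℂ) * p.2) * Complex.exp (-δ * (p.2 : ℂ) ^ 2)) := by
    intro p
    rw [Complex.ofReal_exp, ← Complex.exp_add, ← Complex.exp_add, ← Complex.exp_add, ← Complex.exp_add]
    congr 1
    simp only [planePairing]
    push_cast
    ring
  simp_rw [e1]
  rw [Measure.volume_eq_prod, integral_prod_mul
    (fun u : ℝ => Complex.exp (I * (-x.1 : ℂ) * u) * Complex.exp (-δ * (u : ℂ) ^ 2))
    (fun u : ℝ => Complex.exp (I * (-x.2 : ℂ) * u) * Complex.exp (-δ * (u : ℂ) ^ 2)),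
    fourierIntegral_gaussian hre, fourierIntegral_gaussian hre]
  have h2 : ((π : ℂ) / δ) ^ (1 / 2 : ℂ) * ((π : ℂ) / δ) ^ (1 / 2 : ℂ) = (π : ℂ) / δ := by
    have hne : (π : ℂ) / δ ≠ 0 := by
      have := hδ.ne'
      have := Real.pi_pos.ne'
      norm_cast
      positivity
    rw [← Complex.cpow_add _ _ hne]
    norm_num
  rw [mul_mul_mul_comm, h2, ← Complex.exp_add]
  push_cast
  congr 2
  field_simp
  ring

lemma integrable_gaussian_plane {b : ℝ} (hb : 0 < b) :
    Integrable (fun p : ℝ × ℝ => Real.exp (-b * (p.1 ^ 2 + p.2 ^ 2))) := by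
  have := (integrable_exp_neg_mul_sq hb).mul_prod (integrable_exp_neg_mul_sq hb)
  rw [← Measure.volume_eq_prod] at this
  refine this.congr (ae_of_all _ fun p => ?_)
  simp only
  rw [← Real.exp_add]
  ring_nf

lemma lintegral_gaussian_kernel {δ : ℝ} (hδ : 0 < δ) (y : ℝ × ℝ) :
    ∫⁻ x : ℝ × ℝ, ENNReal.ofReal (π / δ * Real.exp (-(1 / (4 * δ)) *
      ((y.1 - x.1) ^ 2 + (y.2 - x.2) ^ 2))) = ENNReal.ofReal (4 * π ^ 2) := by
  have hb : 0 < 1 / (4 * δ) := by positivity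
  have h0 : ∫⁻ x : ℝ × ℝ, ENNReal.ofReal (π / δ * Real.exp (-(1 / (4 * δ)) *
      ((y.1 - x.1) ^ 2 + (y.2 - x.2) ^ 2))) =
      ∫⁻ x : ℝ × ℝ, ENNReal.ofReal (π / δ * Real.exp (-(1 / (4 * δ)) * (x.1 ^ 2 + x.2 ^ 2))) :=
    lintegral_sub_left_eq_self (fun x : ℝ × ℝ => ENNReal.ofReal (π / δ *
      Real.exp (-(1 / (4 * δ)) * (x.1 ^ 2 + x.2 ^ 2)))) y
  rw [h0, ← ofReal_integral_eq_lintegral_ofReal ((integrable_gaussian_plane hb).const_mul _)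
    (ae_of_all _ fun p => by positivity)]
  congr 1
  rw [integral_const_mul]
  have e1 : ∀ p : ℝ × ℝ, Real.exp (-(1 / (4 * δ)) * (p.1 ^ 2 + p.2 ^ 2)) =
      Real.exp (-(1 / (4 * δ)) * p.1 ^ 2) * Real.exp (-(1 / (4 * δ)) * p.2 ^ 2) := by
    intro p
    rw [← Real.exp_add]
    ring_nf
  simp_rw [e1]
  rw [Measure.volume_eq_prod, integral_prod_mul (fun u : ℝ => Real.exp (-(1 / (4 * δ)) * u ^ 2))
    (fun u : ℝ => Real.exp (-(1 / (4 * δ)) * u ^ 2)), integral_gaussian,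
    Real.mul_self_sqrt (by positivity)]
  field_simp

lemma lintegral_gaussian_mul_planeFourier_le {f : ℝ × ℝ → ℂ} (hf : Measurable f)
    (hfi : Integrable f) {δ : ℝ} (hδ : 0 < δ) :
    ∫⁻ p : ℝ × ℝ, ENNReal.ofReal (Real.exp (-δ * (p.1 ^ 2 + p.2 ^ 2))) * ‖planeFourier f p‖ₑ ^ 2 ≤
      ENNReal.ofReal (4 * π ^ 2) * ∫⁻ x, ‖f x‖ₑ ^ 2 := by
  set G : ℝ × ℝ → ℝ := fun x => π / δ * Real.exp (-(1 / (4 * δ)) * (x.1 ^ 2 + x.2 ^ 2)) with hG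
  have hGm : Measurable G := by fun_prop
  have hGs : ∀ y x, G (y - x) = G (x - y) := by
    intro y x
    simp only [hG, Prod.fst_sub, Prod.snd_sub]
    ring_nf
  have hGi : ∀ y, ∫⁻ x, ENNReal.ofReal (G (y - x)) = ENNReal.ofReal (4 * π ^ 2) :=
    fun y => lintegral_gaussian_kernel hδ y
  set k : ℝ × ℝ → ℂ := fun p => ((Real.exp (-δ * (p.1 ^ 2 + p.2 ^ 2)) : ℝ) : ℂ) with hk
  have hki : Integrable k := (integrable_gaussian_plane hδ).ofReal
  set a : ℝ × ℝ → ℝ × ℝ → ℂ := fun x p => Complex.exp (-I * (planePairing x p : ℂ)) * f x with ha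
  have ham : Measurable (Function.uncurry a) := measurable_uncurry_planeExp hf
  set b : ℝ × ℝ → ℝ × ℝ → ℂ := fun x p => (starRingEnd ℂ) (a x p) with hb
  have hbm : Measurable (Function.uncurry b) := Complex.continuous_conj.measurable.comp ham
  have hFub := integral_mul_bilinear hki ham hbm hfi.norm hfi.norm
    (fun x p => (norm_planeExp f x p).le)
    (fun x p => by rw [hb]; simp only [RCLike.norm_conj]; exact (norm_planeExp f x p).le)
  have hin : ∀ w : (ℝ × ℝ) × (ℝ × ℝ), ∫ p, k p * (a w.1 p * b w.2 p) =
      (f w.1 * (starRingEnd ℂ) (f w.2)) * ((G (w.1 - w.2) : ℝ) : ℂ) := by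
    intro w
    rw [← integral_gaussian_plane hδ (w.1 - w.2), ← integral_const_mul]
    congr 1
    ext p
    simp only [hb, ha, hk]
    rw [conj_planeExp]
    have : Complex.exp (-I * (planePairing (w.1 - w.2) p : ℂ)) =
        Complex.exp (-I * (planePairing w.1 p : ℂ)) * Complex.exp (-I * (planePairing w.2 (-p) : ℂ)) := by
      rw [← Complex.exp_add]
      congr 1
      simp [planePairing]
      ring
    rw [this]
    ring
  simp_rw [hin] at hFub
  have hlhs : ∫⁻ p : ℝ × ℝ, ENNReal.ofReal (Real.exp (-δ * (p.1 ^ 2 + p.2 ^ 2))) *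
      ‖planeFourier f p‖ₑ ^ 2 = ‖∫ p, k p * ((∫ y, a y p) * ∫ y, b y p)‖ₑ := by
    have e1 : ∀ p, k p * ((∫ y, a y p) * ∫ y, b y p) =
        ((Real.exp (-δ * (p.1 ^ 2 + p.2 ^ 2)) * ‖planeFourier f p‖ ^ 2 : ℝ) : ℂ) := by
      intro p
      simp only [hb]
      rw [integral_conj, Complex.mul_conj']
      simp only [hk]
      push_cast
      rfl
    have hint : Integrable fun p : ℝ × ℝ =>
        Real.exp (-δ * (p.1 ^ 2 + p.2 ^ 2)) * ‖planeFourier f p‖ ^ 2 := by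
      refine (integrable_gaussian_plane hδ).mul_bdd (c := (∫ x, ‖f x‖) ^ 2) ?_ (ae_of_all _ fun p => ?_)
      · exact ((measurable_planeFourier hf).norm.pow_const 2).aestronglyMeasurable
      · rw [norm_pow, norm_norm]
        gcongr
        exact norm_planeFourier_le f p
    simp_rw [e1]
    rw [integral_complex_ofReal, ← ofReal_norm, Complex.norm_real, Real.norm_eq_abs,
      abs_of_nonneg (integral_nonneg fun p => by positivity),
      ofReal_integral_eq_lintegral_ofReal hint (ae_of_all _ fun p => by positivity)]
    congr 1
    ext p
    rw [ENNReal.ofReal_mul (Real.exp_pos _).le, ENNReal.ofReal_pow (norm_nonneg _), ofReal_norm]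
  rw [hlhs, hFub]
  have hmeas : Measurable fun w : (ℝ × ℝ) × (ℝ × ℝ) => ENNReal.ofReal (G (w.1 - w.2)) := by fun_prop
  have hm1 : Measurable fun x => ‖f x‖ₑ ^ 2 := by fun_prop
  calc _ ≤ ∫⁻ w : (ℝ × ℝ) × (ℝ × ℝ), ‖(f w.1 * (starRingEnd ℂ) (f w.2)) * ((G (w.1 - w.2) : ℝ) : ℂ)‖ₑ
        ∂(volume.prod volume) := enorm_integral_le_lintegral_enorm _
    _ ≤ ∫⁻ w : (ℝ × ℝ) × (ℝ × ℝ), (2⁻¹ * (‖f w.1‖ₑ ^ 2 * ENNReal.ofReal (G (w.1 - w.2))) +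
        2⁻¹ * (‖f w.2‖ₑ ^ 2 * ENNReal.ofReal (G (w.1 - w.2)))) ∂(volume.prod volume) := by
        refine lintegral_mono fun w => ?_
        have hG0 : 0 ≤ G (w.1 - w.2) := by positivity
        simp only [enorm_mul]
        rw [← mul_add, ← add_mul, ← mul_assoc]
        have e2 : ‖((G (w.1 - w.2) : ℝ) : ℂ)‖ₑ = ENNReal.ofReal (G (w.1 - w.2)) := by
          rw [← ofReal_norm, Complex.norm_real, Real.norm_eq_abs, abs_of_nonneg hG0]
        rw [e2]
        refine mul_le_mul_left ?_ _
        rw [← ofReal_norm, ← ofReal_norm, ← ofReal_norm, RCLike.norm_conj,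
          ← ENNReal.ofReal_mul (norm_nonneg _), ← ENNReal.ofReal_pow (norm_nonneg _),
          ← ENNReal.ofReal_pow (norm_nonneg _), ← ENNReal.ofReal_add (by positivity) (by positivity)]
        have : (2⁻¹ : ENNReal) = ENNReal.ofReal (2⁻¹) := by
          rw [ENNReal.ofReal_inv_of_pos (by norm_num)]; simp
        rw [this, ← ENNReal.ofReal_mul (by positivity)]
        apply ENNReal.ofReal_le_ofReal
        nlinarith [sq_nonneg (‖f w.1‖ - ‖f w.2‖)]
    _ = 2⁻¹ * (ENNReal.ofReal (4 * π ^ 2) * ∫⁻ x, ‖f x‖ₑ ^ 2) +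
        2⁻¹ * (ENNReal.ofReal (4 * π ^ 2) * ∫⁻ x, ‖f x‖ₑ ^ 2) := by
        rw [lintegral_add_left (by fun_prop), lintegral_const_mul _ (by fun_prop),
          lintegral_const_mul _ (by fun_prop)]
        congr 2
        · rw [lintegral_prod _ (by fun_prop)]
          simp only
          rw [← lintegral_const_mul _ hm1]
          congr 1
          ext y
          rw [lintegral_const_mul _ (by fun_prop), hGi, mul_comm]
        · rw [lintegral_prod_symm _ (by fun_prop)]
          simp only
          rw [← lintegral_const_mul _ hm1]
          congr 1
          ext y
          rw [lintegral_const_mul _ (by fun_prop)]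
          simp_rw [fun x => hGs x y]
          rw [hGi, mul_comm]
    _ = _ := by
        rw [← add_mul, ENNReal.inv_two_add_inv_two, one_mul]

/-- The Fourier transform is bounded on `L²`. -/
lemma lintegral_planeFourier_sq_le {f : ℝ × ℝ → ℂ} (hf : Measurable f) (hfi : Integrable f) :
    ∫⁻ p, ‖planeFourier f p‖ₑ ^ 2 ≤ ENNReal.ofReal (4 * π ^ 2) * ∫⁻ x, ‖f x‖ₑ ^ 2 := by
  have hFm := measurable_planeFourier hf
  have hlim : Filter.Tendsto (fun n : ℕ => ∫⁻ p : ℝ × ℝ,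
      ENNReal.ofReal (Real.exp (-(1 / ((n : ℝ) + 1)) * (p.1 ^ 2 + p.2 ^ 2))) * ‖planeFourier f p‖ₑ ^ 2)
      Filter.atTop (nhds (∫⁻ p, ‖planeFourier f p‖ₑ ^ 2)) := by
    refine lintegral_tendsto_of_tendsto_of_monotone (fun n => by fun_prop) (ae_of_all _ fun p => ?_)
      (ae_of_all _ fun p => ?_)
    · intro n m hnm
      simp only
      gcongr ENNReal.ofReal (Real.exp ?_) * _
      rw [neg_mul, neg_mul, neg_le_neg_iff]
      gcongr
    · have h1 : Filter.Tendsto (fun n : ℕ => Real.exp (-(1 / ((n : ℝ) + 1)) * (p.1 ^ 2 + p.2 ^ 2)))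
          Filter.atTop (nhds 1) := by
        have := (tendsto_one_div_add_atTop_nhds_zero_nat (𝕜 := ℝ)).neg.mul_const (p.1 ^ 2 + p.2 ^ 2)
        rw [neg_zero, zero_mul] at this
        have := (Real.continuous_exp.tendsto 0).comp this
        rwa [Real.exp_zero] at this
      have h2 := ENNReal.tendsto_ofReal h1
      rw [ENNReal.ofReal_one] at h2
      have h3 := ENNReal.Tendsto.mul_const (b := ‖planeFourier f p‖ₑ ^ 2) h2 (Or.inl one_ne_zero)
      rwa [one_mul] at h3
  exact le_of_tendsto' hlim fun n => lintegral_gaussian_mul_planeFourier_le hf hfi (by positivity)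

lemma norm_exp_mul_real_le (z : ℂ) {l K : ℝ} (hl : |l| ≤ K) :
    ‖Complex.exp (z * (l : ℂ))‖ ≤ Real.exp (|z.re| * K) := by
  rw [Complex.norm_exp, Complex.re_mul_ofReal]
  refine Real.exp_le_exp.2 ((le_abs_self _).trans ?_)
  rw [abs_mul]
  gcongr

section ExpIntegral

variable {W : Type*} [MeasurableSpace W] {μ : Measure W} {G : W → ℂ} {l : W → ℝ} {K : ℝ}

lemma integrable_exp_mul_real (hG : Integrable G μ) (hl : Measurable l) (hK : ∀ w, |l w| ≤ K) (z : ℂ) :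
    Integrable (fun w => Complex.exp (z * (l w : ℂ)) * G w) μ := by
  refine hG.bdd_mul (c := Real.exp (|z.re| * K)) ?_ (ae_of_all _ fun w => norm_exp_mul_real_le z (hK w))
  apply Measurable.aestronglyMeasurable
  fun_prop

lemma differentiable_integral_exp_mul_real (hG : Integrable G μ) (hl : Measurable l)
    (hK : ∀ w, |l w| ≤ K) :
    Differentiable ℂ fun z : ℂ => ∫ w, Complex.exp (z * (l w : ℂ)) * G w ∂μ := by
  intro z₀
  have h := hasDerivAt_integral_of_dominated_loc_of_deriv_le (μ := μ)
    (F := fun (z : ℂ) w => Complex.exp (z * (l w : ℂ)) * G w)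
    (F' := fun (z : ℂ) w => Complex.exp (z * (l w : ℂ)) * (l w : ℂ) * G w)
    (bound := fun w => Real.exp ((|z₀.re| + 1) * K) * K * ‖G w‖)
    (s := Metric.ball z₀ 1) (x₀ := z₀) (Metric.ball_mem_nhds _ one_pos)
    (Filter.Eventually.of_forall fun z => (integrable_exp_mul_real hG hl hK z).1)
    (integrable_exp_mul_real hG hl hK z₀) ?_ (ae_of_all _ ?_) (hG.norm.const_mul _)
    (ae_of_all _ ?_)
  · exact h.2.differentiableAt
  · refine AEStronglyMeasurable.mul ?_ hG.1
    apply Measurable.aestronglyMeasurable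
    fun_prop
  · intro w z hz
    rw [norm_mul, norm_mul, Complex.norm_real, Real.norm_eq_abs]
    have h1 : |z.re| ≤ |z₀.re| + 1 := by
      have h2 : |(z - z₀).re| ≤ 1 := (Complex.abs_re_le_norm _).trans (by
        rw [← dist_eq_norm]; exact (Metric.mem_ball.1 hz).le)
      rw [Complex.sub_re] at h2
      have := abs_sub_abs_le_abs_sub z.re z₀.re
      linarith
    have hK0 : 0 ≤ K := (abs_nonneg _).trans (hK w)
    have h3 : ‖Complex.exp (z * (l w : ℂ))‖ ≤ Real.exp ((|z₀.re| + 1) * K) :=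
      (norm_exp_mul_real_le z (hK w)).trans (Real.exp_le_exp.2 (by gcongr))
    have := hK w
    gcongr
  · intro w z _
    have : HasDerivAt (fun z : ℂ => Complex.exp (z * (l w : ℂ))) (Complex.exp (z * (l w : ℂ)) * (1 * (l w : ℂ))) z :=
      ((hasDerivAt_id z).mul_const (l w : ℂ)).cexp
    refine (this.mul_const (G w)).congr_deriv ?_
    rw [one_mul]

lemma norm_integral_exp_mul_real_le (hG : Integrable G μ) (hK : ∀ w, |l w| ≤ K) {z : ℂ}
    (hz : |z.re| ≤ 1) (hK0 : 0 ≤ K) :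
    ‖∫ w, Complex.exp (z * (l w : ℂ)) * G w ∂μ‖ ≤ Real.exp K * ∫ w, ‖G w‖ ∂μ := by
  rw [← integral_const_mul]
  refine norm_integral_le_of_norm_le (hG.norm.const_mul _) (ae_of_all _ fun w => ?_)
  rw [norm_mul]
  gcongr
  refine (norm_exp_mul_real_le z (hK w)).trans (Real.exp_le_exp.2 ?_)
  nlinarith

end ExpIntegral

/-- Measurable functions with values bounded above and below (off their zero set), supported on a
set of finite measure. -/
def IsSimpleLike (f : ℝ × ℝ → ℂ) : Prop :=
  Measurable f ∧ (∃ K : ℝ, ∀ x, |Real.log ‖f x‖| ≤ K) ∧ volume (Function.support f) < ⊤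

/-- The analytic family `f |f|^{(z-θ)/(1+θ)}`. -/
noncomputable def analyticFamily (θ : ℝ) (f : ℝ × ℝ → ℂ) (z : ℂ) (x : ℝ × ℝ) : ℂ :=
  Complex.exp ((z - θ) * ((Real.log ‖f x‖ / (1 + θ) : ℝ) : ℂ)) * f x

lemma analyticFamily_self (θ : ℝ) (f : ℝ × ℝ → ℂ) : analyticFamily θ f θ = f := by
  ext x
  simp [analyticFamily]

lemma measurable_analyticFamily {θ : ℝ} {f : ℝ × ℝ → ℂ} (hf : Measurable f) (z : ℂ) :
    Measurable (analyticFamily θ f z) := by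
  unfold analyticFamily
  fun_prop

lemma analyticFamily_eq (θ : ℝ) (f : ℝ × ℝ → ℂ) (z : ℂ) (x : ℝ × ℝ) :
    analyticFamily θ f z x =
      Complex.exp (z * ((Real.log ‖f x‖ / (1 + θ) : ℝ) : ℂ)) * analyticFamily θ f 0 x := by
  simp only [analyticFamily]
  rw [← mul_assoc, ← Complex.exp_add]
  congr 2
  ring

lemma norm_analyticFamily {θ : ℝ} (hθ : 0 < θ) (f : ℝ × ℝ → ℂ) (z : ℂ) (x : ℝ × ℝ) (hz : 0 ≤ z.re) :
    ‖analyticFamily θ f z x‖ = ‖f x‖ ^ ((1 + z.re) / (1 + θ)) := by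
  have h1 : 0 < (1 + z.re) / (1 + θ) := by positivity
  rcases eq_or_ne (f x) 0 with h | h
  · simp [analyticFamily, h, Real.zero_rpow h1.ne']
  · have hpos : 0 < ‖f x‖ := norm_pos_iff.2 h
    unfold analyticFamily
    rw [norm_mul, Complex.norm_exp, Complex.re_mul_ofReal, Complex.sub_re, Complex.ofReal_re]
    nth_rewrite 2 [← Real.exp_log hpos]
    rw [← Real.exp_add, Real.rpow_def_of_pos hpos]
    congr 1
    field_simp
    ring

lemma IsSimpleLike.integrable_rpow {f : ℝ × ℝ → ℂ} (hf : IsSimpleLike f) {s : ℝ} (hs : 0 < s) :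
    Integrable (fun x => ‖f x‖ ^ s) := by
  obtain ⟨hm, ⟨K, hK⟩, hsupp⟩ := hf
  have hms : MeasurableSet (Function.support f) := measurableSet_support hm
  have hI : Integrable ((Function.support f).indicator fun _ : ℝ × ℝ => Real.exp (K * s)) := by
    rw [integrable_indicator_iff hms]
    exact integrableOn_const hsupp.ne
  refine hI.mono' (hm.norm.pow_const s).aestronglyMeasurable (ae_of_all _ fun x => ?_)
  rcases eq_or_ne (f x) 0 with h | h
  · rw [h, norm_zero, Real.zero_rpow hs.ne', norm_zero]
    exact Set.indicator_nonneg (fun _ _ => (Real.exp_pos _).le) _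
  · rw [Set.indicator_of_mem (Function.mem_support.2 h), Real.norm_eq_abs,
      abs_of_nonneg (by positivity), Real.rpow_def_of_pos (norm_pos_iff.2 h)]
    refine Real.exp_le_exp.2 ?_
    gcongr
    exact (le_abs_self _).trans (hK x)

lemma IsSimpleLike.integrable_analyticFamily {f : ℝ × ℝ → ℂ} (hf : IsSimpleLike f) {θ : ℝ} (hθ : 0 < θ)
    {z : ℂ} (hz : 0 ≤ z.re) : Integrable (analyticFamily θ f z) := by
  rw [← integrable_norm_iff (measurable_analyticFamily hf.1 z).aestronglyMeasurable]
  simp_rw [norm_analyticFamily hθ f z _ hz]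
  exact hf.integrable_rpow (by positivity)

lemma lintegral_analyticFamily_sq {f : ℝ × ℝ → ℂ} (hf : IsSimpleLike f) {θ : ℝ} (hθ : 0 < θ) {z : ℂ}
    (hz : z.re = 0) :
    ∫⁻ x, ‖analyticFamily θ f z x‖ₑ ^ 2 = ENNReal.ofReal (∫ x, ‖f x‖ ^ (2 / (1 + θ))) := by
  rw [ofReal_integral_eq_lintegral_ofReal (hf.integrable_rpow (by positivity))
    (ae_of_all _ fun x => by positivity)]
  congr 1
  ext x
  rw [← ofReal_norm, norm_analyticFamily hθ f z x hz.ge, hz, ← ENNReal.ofReal_pow (by positivity),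
    ← Real.rpow_natCast, ← Real.rpow_mul (norm_nonneg _)]
  congr 2
  push_cast
  ring

/-- The logarithm of `|ξ|^{-κ}` on the truncation region. -/
noncomputable def truncatedLog (κ ε R : ℝ) (p : ℝ × ℝ) : ℝ :=
  if ε < |p.1| ∧ |p.1| < R then -κ * Real.log |p.1| else 0

lemma measurable_truncatedLog (κ ε R : ℝ) : Measurable (truncatedLog κ ε R) := by
  unfold truncatedLog
  refine Measurable.ite (measurableSet_truncation ε R) ?_ measurable_const
  have h1 : Measurable (fun p : ℝ × ℝ => Real.log |p.1|) := by fun_prop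
  fun_prop

lemma abs_truncatedLog_le {κ ε R : ℝ} (hε : 0 < ε) (p : ℝ × ℝ) :
    |truncatedLog κ ε R p| ≤ |κ| * (|Real.log ε| + |Real.log R|) := by
  unfold truncatedLog
  split_ifs with h
  · rw [abs_mul, abs_neg]
    gcongr
    exact abs_log_le_of_mem hε h.1 h.2
  · rw [abs_zero]; positivity

lemma truncatedSymbol_eq (κ ε R δ : ℝ) (z : ℂ) (p : ℝ × ℝ) :
    truncatedSymbol κ ε R δ z p =
      Complex.exp (z * (truncatedLog κ ε R p : ℂ)) * truncatedSymbol κ ε R δ 0 p := by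
  unfold truncatedSymbol truncatedLog
  split_ifs with h
  · simp
  · simp

/-- The bilinear form whose kernel is the truncated propagator. -/
noncomputable def truncatedForm (κ α ε R δ t : ℝ) (z : ℂ) (f h : ℝ × ℝ → ℂ) : ℂ :=
  ∫ p, (truncatedSymbol κ ε R δ z p * Complex.exp (-I * ((t * kpPhase α p : ℝ) : ℂ))) *
    (planeFourier f p * planeFourier h (-p))

lemma measurable_mul_kpPhase (α t : ℝ) : Measurable fun p => t * kpPhase α p :=
  (measurable_kpPhase α).const_mul t

lemma measurable_uncurry_planeExp_neg {f : ℝ × ℝ → ℂ} (hf : Measurable f) :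
    Measurable (Function.uncurry fun x p : ℝ × ℝ =>
      Complex.exp (-I * (planePairing x (-p) : ℂ)) * f x) := by
  unfold Function.uncurry planePairing
  fun_prop

lemma truncatedForm_eq_integral {κ α ε R δ t : ℝ} (hε : 0 < ε) (hδ : 0 < δ) (z : ℂ)
    {f h : ℝ × ℝ → ℂ} (hf : Measurable f) (hfi : Integrable f) (hh : Measurable h)
    (hhi : Integrable h) :
    truncatedForm κ α ε R δ t z f h = ∫ w : (ℝ × ℝ) × (ℝ × ℝ), ∫ p,
      (truncatedSymbol κ ε R δ z p * Complex.exp (-I * ((t * kpPhase α p : ℝ) : ℂ))) *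
      ((Complex.exp (-I * (planePairing w.1 p : ℂ)) * f w.1) *
        (Complex.exp (-I * (planePairing w.2 (-p) : ℂ)) * h w.2)) ∂(volume.prod volume) :=
  integral_mul_bilinear
    (integrable_truncatedSymbol_mul_exp hε hδ z (measurable_mul_kpPhase α t))
    (measurable_uncurry_planeExp hf) (measurable_uncurry_planeExp_neg hh) hfi.norm hhi.norm
    (fun x p => (norm_planeExp f x p).le) (fun x p => (norm_planeExp h x (-p)).le)

lemma integrable_truncatedForm {κ α ε R δ t : ℝ} (hε : 0 < ε) (hδ : 0 < δ) (z : ℂ)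
    {f h : ℝ × ℝ → ℂ} (hf : Measurable f) (hfi : Integrable f) (hh : Measurable h)
    (hhi : Integrable h) :
    Integrable (fun w : ((ℝ × ℝ) × (ℝ × ℝ)) × (ℝ × ℝ) =>
      (truncatedSymbol κ ε R δ z w.2 * Complex.exp (-I * ((t * kpPhase α w.2 : ℝ) : ℂ))) *
      ((Complex.exp (-I * (planePairing w.1.1 w.2 : ℂ)) * f w.1.1) *
        (Complex.exp (-I * (planePairing w.1.2 (-w.2) : ℂ)) * h w.1.2)))
      ((volume.prod volume).prod volume) :=
  integrable_mul_bilinear (ν := volume) (μ := volume)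
    (k := fun p => truncatedSymbol κ ε R δ z p * Complex.exp (-I * ((t * kpPhase α p : ℝ) : ℂ)))
    (a := fun x p => Complex.exp (-I * (planePairing x p : ℂ)) * f x)
    (b := fun x p => Complex.exp (-I * (planePairing x (-p) : ℂ)) * h x)
    (integrable_truncatedSymbol_mul_exp hε hδ z (measurable_mul_kpPhase α t))
    (measurable_uncurry_planeExp hf) (measurable_uncurry_planeExp_neg hh) hfi.norm hhi.norm
    (fun x p => (norm_planeExp f x p).le) (fun x p => (norm_planeExp h x (-p)).le)

lemma exists_entire_truncatedForm {κ α ε R δ t θ : ℝ} (hε : 0 < ε) (hδ : 0 < δ) (hθ : 0 < θ)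
    {f h : ℝ × ℝ → ℂ} (hf : IsSimpleLike f) (hh : IsSimpleLike h) :
    ∃ Ψ : ℂ → ℂ, Differentiable ℂ Ψ ∧ (∃ B, ∀ z : ℂ, |z.re| ≤ 1 → ‖Ψ z‖ ≤ B) ∧
      ∀ z : ℂ, 0 ≤ z.re → Ψ z =
        truncatedForm κ α ε R δ t z (analyticFamily θ f z) (analyticFamily θ h z) := by
  set T : ℂ → ((ℝ × ℝ) × (ℝ × ℝ)) × (ℝ × ℝ) → ℂ := fun z w =>
      (truncatedSymbol κ ε R δ z w.2 * Complex.exp (-I * ((t * kpPhase α w.2 : ℝ) : ℂ))) *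
      ((Complex.exp (-I * (planePairing w.1.1 w.2 : ℂ)) * analyticFamily θ f z w.1.1) *
        (Complex.exp (-I * (planePairing w.1.2 (-w.2) : ℂ)) * analyticFamily θ h z w.1.2)) with hT
  have hTi : ∀ z : ℂ, 0 ≤ z.re → Integrable (T z) ((volume.prod volume).prod volume) := fun z hz =>
    integrable_truncatedForm hε hδ z (measurable_analyticFamily hf.1 z)
      (hf.integrable_analyticFamily hθ hz) (measurable_analyticFamily hh.1 z)
      (hh.integrable_analyticFamily hθ hz)
  obtain ⟨K₁, hK₁⟩ := hf.2.1
  obtain ⟨K₂, hK₂⟩ := hh.2.1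
  have hfm := hf.1
  have hhm := hh.1
  set l : ((ℝ × ℝ) × (ℝ × ℝ)) × (ℝ × ℝ) → ℝ := fun w => truncatedLog κ ε R w.2 +
    (Real.log ‖f w.1.1‖ / (1 + θ) + Real.log ‖h w.1.2‖ / (1 + θ)) with hl
  have hlm : Measurable l := by
    have := measurable_truncatedLog κ ε R
    fun_prop
  have hlK : ∀ w, |l w| ≤ |κ| * (|Real.log ε| + |Real.log R|) + (K₁ / (1 + θ) + K₂ / (1 + θ)) := by
    intro w
    refine (abs_add_le _ _).trans (add_le_add (abs_truncatedLog_le hε _)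
      ((abs_add_le _ _).trans (add_le_add ?_ ?_)))
    · rw [abs_div, abs_of_pos (by positivity : 0 < 1 + θ)]
      have := hK₁ w.1.1
      gcongr
    · rw [abs_div, abs_of_pos (by positivity : 0 < 1 + θ)]
      have := hK₂ w.1.2
      gcongr
  have hTe : ∀ z w, T z w = Complex.exp (z * (l w : ℂ)) * T 0 w := by
    intro z w
    simp only [hT, hl]
    rw [truncatedSymbol_eq κ ε R δ z, analyticFamily_eq θ f z, analyticFamily_eq θ h z]
    have : Complex.exp (z * ((truncatedLog κ ε R w.2 +
        (Real.log ‖f w.1.1‖ / (1 + θ) + Real.log ‖h w.1.2‖ / (1 + θ)) : ℝ) : ℂ)) =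
        Complex.exp (z * (truncatedLog κ ε R w.2 : ℂ)) *
        (Complex.exp (z * ((Real.log ‖f w.1.1‖ / (1 + θ) : ℝ) : ℂ)) *
        Complex.exp (z * ((Real.log ‖h w.1.2‖ / (1 + θ) : ℝ) : ℂ))) := by
      rw [← Complex.exp_add, ← Complex.exp_add]
      congr 1
      push_cast
      ring
    rw [this]
    ring
  have h0 : Integrable (T 0) ((volume.prod volume).prod volume) := hTi 0 (by simp)
  refine ⟨fun z => ∫ w, Complex.exp (z * (l w : ℂ)) * T 0 w ∂((volume.prod volume).prod volume),
    differentiable_integral_exp_mul_real h0 hlm hlK, ⟨_, fun z hz =>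
      norm_integral_exp_mul_real_le h0 hlK hz ((abs_nonneg _).trans (hlK 0))⟩, fun z hz => ?_⟩
  rw [truncatedForm_eq_integral hε hδ z (measurable_analyticFamily hf.1 z)
      (hf.integrable_analyticFamily hθ hz) (measurable_analyticFamily hh.1 z)
      (hh.integrable_analyticFamily hθ hz)]
  simp_rw [← hTe]
  exact integral_prod (T z) (hTi z hz)

lemma lintegral_enorm_mul_le {X : Type*} [MeasurableSpace X] {μ : Measure X} {u v : X → ENNReal}
    (hu : AEMeasurable u μ) (hv : AEMeasurable v μ) :
    ∫⁻ x, u x * v x ∂μ ≤ (∫⁻ x, u x ^ 2 ∂μ) ^ (1 / 2 : ℝ) * (∫⁻ x, v x ^ 2 ∂μ) ^ (1 / 2 : ℝ) := by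
  have h := ENNReal.lintegral_mul_le_Lp_mul_Lq μ Real.HolderConjugate.two_two hu hv
  simpa using h

/-- The `L²` endpoint. -/
lemma norm_truncatedForm_le_of_re_zero {κ α ε R δ t : ℝ} (hδ : 0 < δ)
    {z : ℂ} (hz : z.re = 0) {f h : ℝ × ℝ → ℂ} (hf : Measurable f) (hfi : Integrable f)
    (hh : Measurable h) (hhi : Integrable h) {X Y : ℝ} (hX : 0 ≤ X) (hY : 0 ≤ Y)
    (hfX : ∫⁻ x, ‖f x‖ₑ ^ 2 = ENNReal.ofReal X) (hhY : ∫⁻ x, ‖h x‖ₑ ^ 2 = ENNReal.ofReal Y) :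
    ‖truncatedForm κ α ε R δ t z f h‖ ≤ 4 * π ^ 2 * (X ^ (1 / 2 : ℝ) * Y ^ (1 / 2 : ℝ)) := by
  have hF := measurable_planeFourier hf
  have hH := measurable_planeFourier hh
  have h1 : ∀ p, ‖(truncatedSymbol κ ε R δ z p * Complex.exp (-I * ((t * kpPhase α p : ℝ) : ℂ))) *
      (planeFourier f p * planeFourier h (-p))‖ₑ ≤ ‖planeFourier f p‖ₑ * ‖planeFourier h (-p)‖ₑ := by
    intro p
    rw [enorm_mul, ← enorm_mul (planeFourier f p)]
    refine mul_le_of_le_one_left' ?_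
    rw [← ofReal_norm, norm_mul, norm_exp_neg_I_mul, mul_one, norm_truncatedSymbol, hz]
    rw [← ENNReal.ofReal_one]
    apply ENNReal.ofReal_le_ofReal
    split_ifs
    · rw [mul_zero, neg_zero, zero_mul, Real.exp_zero, one_mul]
      apply Real.exp_le_one_iff.2
      rw [neg_nonpos]
      positivity
    · exact zero_le_one
  have hneg : ∫⁻ p, ‖planeFourier h (-p)‖ₑ ^ 2 = ∫⁻ p, ‖planeFourier h p‖ₑ ^ 2 :=
    lintegral_neg_eq_self (fun p => ‖planeFourier h p‖ₑ ^ 2)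
  have hb := lintegral_planeFourier_sq_le hf hfi
  have hb' := lintegral_planeFourier_sq_le hh hhi
  rw [hfX, ← ENNReal.ofReal_mul (by positivity)] at hb
  rw [hhY, ← ENNReal.ofReal_mul (by positivity)] at hb'
  have h2 : ‖truncatedForm κ α ε R δ t z f h‖ₑ ≤
      ENNReal.ofReal (4 * π ^ 2 * (X ^ (1 / 2 : ℝ) * Y ^ (1 / 2 : ℝ))) := by
    calc _ ≤ ∫⁻ p, _ := enorm_integral_le_lintegral_enorm _
      _ ≤ ∫⁻ p, ‖planeFourier f p‖ₑ * ‖planeFourier h (-p)‖ₑ := lintegral_mono h1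
      _ ≤ _ := lintegral_enorm_mul_le (by fun_prop) (by fun_prop)
      _ ≤ (ENNReal.ofReal (4 * π ^ 2 * X)) ^ (1 / 2 : ℝ) * (ENNReal.ofReal (4 * π ^ 2 * Y)) ^ (1 / 2 : ℝ) := by
        rw [hneg]
        gcongr
      _ = _ := by
        rw [ENNReal.ofReal_rpow_of_nonneg (by positivity) (by norm_num),
          ENNReal.ofReal_rpow_of_nonneg (by positivity) (by norm_num),
          ← ENNReal.ofReal_mul (by positivity)]
        congr 1
        rw [Real.mul_rpow (by positivity) hX, Real.mul_rpow (by positivity) hY, mul_mul_mul_comm,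
          ← Real.rpow_add (by positivity)]
        norm_num
  rw [← ofReal_norm] at h2
  exact (ENNReal.ofReal_le_ofReal_iff (by positivity)).1 h2

/-- The dispersive endpoint. -/
lemma norm_truncatedForm_le_of_re_one {α ε R δ t s : ℝ} (hα : 1 < α) (hε : 0 < ε) (hR : ε ≤ R)
    (hδ : 0 < δ) (ht : t ≠ 0) {f h : ℝ × ℝ → ℂ} (hf : Measurable f) (hfi : Integrable f)
    (hh : Measurable h) (hhi : Integrable h) :
    ‖truncatedForm (1 - α / 2) α ε R δ t (1 + s * I) f h‖ ≤
      52 * π ^ (1 / 2 : ℝ) * (1 + |(1 - α / 2) * s|) * |t|⁻¹ * ((∫ x, ‖f x‖) * ∫ x, ‖h x‖) := by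
  rw [truncatedForm_eq_integral hε hδ _ hf hfi hh hhi]
  rw [← integral_prod_mul (fun x => ‖f x‖) (fun x => ‖h x‖), ← integral_const_mul]
  refine norm_integral_le_of_norm_le ((hfi.norm.mul_prod hhi.norm).const_mul _)
    (ae_of_all _ fun w => ?_)
  have e1 : ∀ p, (truncatedSymbol (1 - α / 2) ε R δ (1 + s * I) p *
        Complex.exp (-I * ((t * kpPhase α p : ℝ) : ℂ))) *
      ((Complex.exp (-I * (planePairing w.1 p : ℂ)) * f w.1) *
        (Complex.exp (-I * (planePairing w.2 (-p) : ℂ)) * h w.2)) =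
      (truncatedSymbol (1 - α / 2) ε R δ (1 + s * I) p *
        Complex.exp (-I * ((planePairing (w.1 - w.2) p + t * kpPhase α p : ℝ) : ℂ))) *
        (f w.1 * h w.2) := by
    intro p
    have : Complex.exp (-I * ((planePairing (w.1 - w.2) p + t * kpPhase α p : ℝ) : ℂ)) =
        Complex.exp (-I * ((t * kpPhase α p : ℝ) : ℂ)) * (Complex.exp (-I * (planePairing w.1 p : ℂ)) *
          Complex.exp (-I * (planePairing w.2 (-p) : ℂ))) := by
      rw [← Complex.exp_add, ← Complex.exp_add]
      congr 1
      simp [planePairing]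
      ring
    rw [this]
    ring
  simp_rw [e1]
  rw [integral_mul_const, norm_mul, norm_mul]
  gcongr
  exact norm_kernel_le hα hε hR hδ ht

lemma one_add_abs_mul_exp_le (κ s : ℝ) :
    (1 + |κ * s|) * Real.exp (1 - s ^ 2) ≤ 2 * Real.exp 1 * (1 + |κ|) := by
  have h1 : 1 + |κ * s| ≤ (1 + |κ|) * (2 * (s ^ 2 + 1)) := by
    rw [abs_mul]
    have : |s| ^ 2 = s ^ 2 := sq_abs s
    have h0 := abs_nonneg κ
    have h2 : |s| ≤ 2 * (s ^ 2 + 1) := by nlinarith [sq_nonneg (|s| - 1)]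
    nlinarith [mul_le_mul_of_nonneg_left h2 h0, sq_nonneg s]
  have h2 : s ^ 2 + 1 ≤ Real.exp (s ^ 2) := Real.add_one_le_exp _
  rw [Real.exp_sub]
  calc _ ≤ (1 + |κ|) * (2 * Real.exp (s ^ 2)) * (Real.exp 1 / Real.exp (s ^ 2)) := by
        have h3 : (1 + |κ|) * (2 * (s ^ 2 + 1)) ≤ (1 + |κ|) * (2 * Real.exp (s ^ 2)) := by
          have := abs_nonneg κ
          gcongr
        exact mul_le_mul_of_nonneg_right (h1.trans h3) (by positivity)
    _ = _ := by field_simp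

/-- The constant in the fixed-time decay estimate. -/
noncomputable def decayConst (α θ : ℝ) : ℝ :=
  (4 * π ^ 2) ^ (1 - θ) * (52 * π ^ (1 / 2 : ℝ) * (2 * Real.exp 1 * (1 + |1 - α / 2|))) ^ θ

lemma norm_exp_sq (z : ℂ) : ‖Complex.exp (z ^ 2)‖ = Real.exp (z.re ^ 2 - z.im ^ 2) := by
  rw [Complex.norm_exp]
  congr 1
  rw [sq, Complex.mul_re]
  ring

/-- Stein interpolation between the two endpoints. -/
lemma norm_truncatedForm_le {α ε R δ t θ : ℝ} (hα : 1 < α) (hε : 0 < ε) (hR : ε ≤ R)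
    (hδ : 0 < δ) (ht : t ≠ 0) (hθ : 0 < θ) (hθ1 : θ < 1) {f h : ℝ × ℝ → ℂ} (hf : IsSimpleLike f)
    (hh : IsSimpleLike h) :
    ‖truncatedForm (1 - α / 2) α ε R δ t θ f h‖ ≤ decayConst α θ * |t| ^ (-θ) *
      ((∫ x, ‖f x‖ ^ (2 / (1 + θ))) ^ ((1 + θ) / 2) * (∫ x, ‖h x‖ ^ (2 / (1 + θ))) ^ ((1 + θ) / 2)) := by
  set X := ∫ x, ‖f x‖ ^ (2 / (1 + θ)) with hX
  set Y := ∫ x, ‖h x‖ ^ (2 / (1 + θ)) with hY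
  have hX0 : 0 ≤ X := integral_nonneg fun x => by positivity
  have hY0 : 0 ≤ Y := integral_nonneg fun x => by positivity
  have hta : 0 < |t| := abs_pos.2 ht
  obtain ⟨Ψ, hΨd, ⟨B, hB⟩, hΨ⟩ := exists_entire_truncatedForm (κ := 1 - α / 2) (α := α) (R := R) (t := t)
    hε hδ hθ hf hh
  set a : ℝ := 4 * π ^ 2 * (X ^ (1 / 2 : ℝ) * Y ^ (1 / 2 : ℝ)) with ha
  set C₁ : ℝ := 52 * π ^ (1 / 2 : ℝ) * (2 * Real.exp 1 * (1 + |1 - α / 2|)) with hC₁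
  set b : ℝ := C₁ * |t|⁻¹ * (X * Y) with hb
  have key := Complex.HadamardThreeLines.norm_le_interp_of_mem_verticalClosedStrip'
    (f := fun z => Complex.exp (z ^ 2) * Ψ z) (z := (θ : ℂ)) (a := a) (b := b) zero_lt_one
    ?_ ?_ ?_ ?_ ?_
  · simp only [Complex.ofReal_re, sub_zero, div_one] at key
    rw [hΨ θ (by simpa using hθ.le), analyticFamily_self, analyticFamily_self, norm_mul] at key
    have h1 : 1 ≤ ‖Complex.exp ((θ : ℂ) ^ 2)‖ := by
      rw [norm_exp_sq]
      apply Real.one_le_exp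
      simp
      positivity
    refine (le_mul_of_one_le_left (norm_nonneg _) h1).trans (key.trans_eq ?_)
    have hx : ∀ u : ℝ, 0 ≤ u → (u ^ (1 / 2 : ℝ)) ^ (1 - θ) * u ^ θ = u ^ ((1 + θ) / 2) := by
      intro u hu
      rw [← Real.rpow_mul hu, ← Real.rpow_add_of_nonneg hu (by nlinarith) hθ.le]
      congr 1
      ring
    have hC₁0 : 0 ≤ C₁ := by positivity
    rw [ha, hb, Real.mul_rpow (x := 4 * π ^ 2) (by positivity) (by positivity),
      Real.mul_rpow (x := X ^ (1 / 2 : ℝ)) (by positivity) (by positivity),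
      Real.mul_rpow (x := C₁ * |t|⁻¹) (by positivity) (by positivity),
      Real.mul_rpow (x := C₁) (by positivity) (by positivity),
      Real.mul_rpow hX0 hY0, ← hx X hX0, ← hx Y hY0,
      Real.inv_rpow hta.le, ← Real.rpow_neg hta.le, decayConst]
    ring
  · simp [Complex.HadamardThreeLines.verticalClosedStrip, hθ.le, hθ1.le]
  · apply Differentiable.diffContOnCl
    fun_prop
  · refine ⟨Real.exp 1 * B, ?_⟩
    rintro _ ⟨z, hz, rfl⟩
    simp only [Complex.HadamardThreeLines.verticalClosedStrip, Set.mem_preimage, Set.mem_Icc] at hz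
    simp only [Function.comp, norm_mul]
    have := hB z (by rw [abs_le]; constructor <;> linarith)
    gcongr
    rw [norm_exp_sq]
    apply Real.exp_le_exp.2
    nlinarith [sq_nonneg z.im]
  · intro z hz
    simp only [Set.mem_preimage, Set.mem_singleton_iff] at hz
    rw [norm_mul, hΨ z hz.ge]
    have h1 : ‖Complex.exp (z ^ 2)‖ ≤ 1 := by
      rw [norm_exp_sq, hz, Real.exp_le_one_iff]
      nlinarith [sq_nonneg z.im]
    refine (mul_le_of_le_one_left (norm_nonneg _) h1).trans ?_
    exact norm_truncatedForm_le_of_re_zero hδ hz (measurable_analyticFamily hf.1 z)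
      (hf.integrable_analyticFamily hθ hz.ge) (measurable_analyticFamily hh.1 z)
      (hh.integrable_analyticFamily hθ hz.ge) hX0 hY0 (lintegral_analyticFamily_sq hf hθ hz)
      (lintegral_analyticFamily_sq hh hθ hz)
  · intro z hz
    simp only [Set.mem_preimage, Set.mem_singleton_iff] at hz
    have hz0 : 0 ≤ z.re := by rw [hz]; exact zero_le_one
    have hze : z = 1 + z.im * I := by
      rw [← Complex.re_add_im z, hz]; simp
    rw [norm_mul, hΨ z hz0]
    have h1 := norm_truncatedForm_le_of_re_one (s := z.im) hα hε hR hδ ht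
      (measurable_analyticFamily (θ := θ) hf.1 z)
      (hf.integrable_analyticFamily hθ hz0) (measurable_analyticFamily (θ := θ) hh.1 z)
      (hh.integrable_analyticFamily hθ hz0)
    rw [← hze] at h1
    simp_rw [norm_analyticFamily hθ _ z _ hz0, hz] at h1
    rw [show (1 + 1 : ℝ) = 2 by norm_num, ← hX, ← hY] at h1
    rw [norm_exp_sq, hz, one_pow]
    have h2 := one_add_abs_mul_exp_le (1 - α / 2) z.im
    calc _ ≤ Real.exp (1 - z.im ^ 2) * _ := mul_le_mul_of_nonneg_left h1 (Real.exp_pos _).le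
      _ = 52 * π ^ (1 / 2 : ℝ) * ((1 + |(1 - α / 2) * z.im|) * Real.exp (1 - z.im ^ 2)) *
          (|t|⁻¹ * (X * Y)) := by ring
      _ ≤ 52 * π ^ (1 / 2 : ℝ) * (2 * Real.exp 1 * (1 + |1 - α / 2|)) * (|t|⁻¹ * (X * Y)) := by gcongr
      _ = _ := by rw [hb, hC₁]; ring

lemma lintegral_comp_abs_eq (G : ℝ → ENNReal) :
    ∫⁻ u : ℝ, G |u| = 2 * ∫⁻ u in Set.Ioi (0 : ℝ), G u := by
  have h1 : ∫⁻ u in Set.Ioi (0 : ℝ), G |u| = ∫⁻ u in Set.Ioi (0 : ℝ), G u :=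
    setLIntegral_congr_fun measurableSet_Ioi fun u hu => by
      rw [abs_of_pos (Set.mem_Ioi.1 hu)]
  have h2 : ∫⁻ u in Set.Iic (0 : ℝ), G |u| = ∫⁻ u in Set.Ioi (0 : ℝ), G |u| := by
    rw [← setLIntegral_congr (Iio_ae_eq_Iic (μ := volume) (a := (0 : ℝ))),
      ← lintegral_indicator measurableSet_Iio, ← lintegral_indicator measurableSet_Ioi,
      ← lintegral_neg_eq_self]
    congr 1
    ext u
    by_cases hu : 0 < u
    · rw [Set.indicator_of_mem (by simpa using hu), Set.indicator_of_mem (by simpa using hu), abs_neg]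
    · rw [Set.indicator_of_notMem (by simpa using hu), Set.indicator_of_notMem (by simpa using hu)]
  rw [← lintegral_add_compl _ (measurableSet_Ioi (a := (0 : ℝ))), Set.compl_Ioi, h2, h1, two_mul]

lemma lintegral_near_kernel {θ ρ : ℝ} (hθ1 : θ < 1) (hρ : 0 < ρ) (t : ℝ) :
    ∫⁻ s : ℝ, (if |t - s| < ρ then ENNReal.ofReal (|t - s| ^ (-θ)) else 0) =
      ENNReal.ofReal (2 * (ρ ^ (1 - θ) / (1 - θ))) := by
  rw [lintegral_sub_left_eq_self (fun u : ℝ => if |u| < ρ then ENNReal.ofReal (|u| ^ (-θ)) else 0) t,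
    lintegral_comp_abs_eq (fun u : ℝ => if u < ρ then ENNReal.ofReal (u ^ (-θ)) else 0),
    ENNReal.ofReal_mul zero_le_two, ENNReal.ofReal_ofNat]
  congr 1
  have hi : IntervalIntegrable (fun u : ℝ => u ^ (-θ)) volume 0 ρ :=
    intervalIntegral.intervalIntegrable_rpow' (by linarith)
  have h1 : ∫ u in Set.Ioc 0 ρ, u ^ (-θ) = ρ ^ (1 - θ) / (1 - θ) := by
    rw [← intervalIntegral.integral_of_le hρ.le, integral_rpow (Or.inl (by linarith)),
      Real.zero_rpow (by linarith), sub_zero, neg_add_eq_sub]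
  rw [← h1, ofReal_integral_eq_lintegral_ofReal ((intervalIntegrable_iff_integrableOn_Ioc_of_le hρ.le).1 hi)
    ((ae_restrict_mem measurableSet_Ioc).mono fun u hu => Real.rpow_nonneg hu.1.le _),
    ← setLIntegral_congr (Ioo_ae_eq_Ioc (μ := volume) (a := (0 : ℝ)) (b := ρ)),
    ← lintegral_indicator measurableSet_Ioi, ← lintegral_indicator measurableSet_Ioo]
  congr 1
  ext u
  by_cases h0 : 0 < u <;> by_cases h2 : u < ρ <;> simp [Set.indicator, h0, h2]

lemma lintegral_far_kernel {θ ρ : ℝ} (hθ : 0 < θ) (hρ : 0 < ρ) (t : ℝ) :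
    ∫⁻ s : ℝ, (if |t - s| < ρ then 0 else ENNReal.ofReal (|t - s| ^ (-θ))) ^ (2 / θ) =
      ENNReal.ofReal (2 / ρ) := by
  have h0 : ∀ u : ℝ, (if |u| < ρ then 0 else ENNReal.ofReal (|u| ^ (-θ))) ^ (2 / θ) =
      if |u| < ρ then 0 else ENNReal.ofReal (|u| ^ (-2 : ℝ)) := by
    intro u
    split_ifs
    · exact ENNReal.zero_rpow_of_pos (by positivity)
    · rw [ENNReal.ofReal_rpow_of_nonneg (by positivity) (by positivity), ← Real.rpow_mul (abs_nonneg _)]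
      congr 2
      field_simp
  simp_rw [h0]
  rw [lintegral_sub_left_eq_self (fun u : ℝ => if |u| < ρ then 0 else ENNReal.ofReal (|u| ^ (-2 : ℝ))) t,
    lintegral_comp_abs_eq (fun u : ℝ => if u < ρ then 0 else ENNReal.ofReal (u ^ (-2 : ℝ))),
    div_eq_mul_inv, ENNReal.ofReal_mul zero_le_two, ENNReal.ofReal_ofNat]
  congr 1
  have h1 : ∫ u in Set.Ioi ρ, u ^ (-2 : ℝ) = ρ⁻¹ := by
    rw [integral_Ioi_rpow_of_lt (by norm_num) hρ]
    norm_num [Real.rpow_neg_one]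
  rw [← h1, ofReal_integral_eq_lintegral_ofReal (integrableOn_Ioi_rpow_of_lt (by norm_num) hρ)
    ((ae_restrict_mem measurableSet_Ioi).mono fun u hu => Real.rpow_nonneg (hρ.trans hu).le _),
    setLIntegral_congr (Ioi_ae_eq_Ici (μ := volume) (a := ρ)),
    ← lintegral_indicator measurableSet_Ioi, ← lintegral_indicator measurableSet_Ici]
  congr 1
  ext u
  by_cases h2 : u < ρ
  · simp [Set.indicator, h2]
  · have h3 : 0 < u := hρ.trans_le (not_lt.1 h2)
    simp [Set.indicator, h3, not_lt.1 h2, h2]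

/-- Splitting the Riesz potential of `f`, cut off at height `f t`, at distance `ρ`. -/
lemma lintegral_cutoff_le_of_pos {θ ρ : ℝ} (hθ : 0 < θ) (hθ1 : θ < 1) (hρ : 0 < ρ) {f : ℝ → ENNReal}
    (hf : Measurable f) (t : ℝ) :
    ∫⁻ s, (if f s ≤ f t then f s * ENNReal.ofReal (|t - s| ^ (-θ)) else 0) ≤
      f t * ENNReal.ofReal (2 * (ρ ^ (1 - θ) / (1 - θ))) +
      (∫⁻ s, f s ^ (2 / (2 - θ))) ^ (1 / (2 / (2 - θ))) * ENNReal.ofReal (2 / ρ) ^ (1 / (2 / θ)) := by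
  set K₁ : ℝ → ENNReal := fun s => if |t - s| < ρ then ENNReal.ofReal (|t - s| ^ (-θ)) else 0 with hK₁
  set K₂ : ℝ → ENNReal := fun s => if |t - s| < ρ then 0 else ENNReal.ofReal (|t - s| ^ (-θ)) with hK₂
  have hs : MeasurableSet {s : ℝ | |t - s| < ρ} := measurableSet_lt (by fun_prop) measurable_const
  have hm1 : Measurable K₁ := Measurable.ite hs (by fun_prop) measurable_const
  have hm2 : Measurable K₂ := Measurable.ite hs measurable_const (by fun_prop)
  have hconj : Real.HolderConjugate (2 / (2 - θ)) (2 / θ) := by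
    rw [Real.holderConjugate_iff]
    constructor
    · rw [lt_div_iff₀ (by linarith)]; linarith
    · have : 2 - θ ≠ 0 := by linarith
      field_simp
      ring
  calc _ ≤ ∫⁻ s, (f t * K₁ s + (f * K₂) s) := by
        refine lintegral_mono fun s => ?_
        simp only [hK₁, hK₂, Pi.mul_apply]
        split_ifs with h1 h2
        · rw [mul_zero, add_zero]; gcongr
        · rw [mul_zero, zero_add]
        all_goals exact zero_le
    _ = f t * (∫⁻ s, K₁ s) + ∫⁻ s, (f * K₂) s := by
        rw [lintegral_add_left (hm1.const_mul _), lintegral_const_mul _ hm1]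
    _ ≤ _ := by
        rw [lintegral_near_kernel hθ1 hρ]
        gcongr
        rw [← lintegral_far_kernel hθ hρ t]
        exact ENNReal.lintegral_mul_le_Lp_mul_Lq volume hconj hf.aemeasurable hm2.aemeasurable

lemma cutoff_bound_eq {θ : ℝ} (hθ : 0 < θ) (hθ1 : θ < 1) {N a : ℝ} (hN : 0 < N) (ha : 0 < a) :
    a * (2 * (((N / a) ^ (2 / (2 - θ))) ^ (1 - θ) / (1 - θ))) +
      N * (2 / (N / a) ^ (2 / (2 - θ))) ^ (1 / (2 / θ)) =
    (2 / (1 - θ) + 2 ^ (θ / 2)) * (N ^ (2 - 2 / (2 - θ)) * a ^ (2 / (2 - θ) - 1)) := by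
  have h2 : 2 - θ ≠ 0 := by linarith
  have h3 : 1 - θ ≠ 0 := by linarith
  have hNa : 0 < N / a := by positivity
  have e1 : a * ((N / a) ^ (2 / (2 - θ))) ^ (1 - θ) = N ^ (2 - 2 / (2 - θ)) * a ^ (2 / (2 - θ) - 1) := by
    rw [← Real.rpow_mul hNa.le, Real.div_rpow hN.le ha.le,
      show 2 / (2 - θ) * (1 - θ) = 2 - 2 / (2 - θ) by field_simp; ring,
      show 2 / (2 - θ) - 1 = 1 - (2 - 2 / (2 - θ)) by ring, Real.rpow_sub ha 1, Real.rpow_one]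
    ring
  have e2 : N * (2 / (N / a) ^ (2 / (2 - θ))) ^ (1 / (2 / θ)) =
      2 ^ (θ / 2) * (N ^ (2 - 2 / (2 - θ)) * a ^ (2 / (2 - θ) - 1)) := by
    rw [Real.div_rpow zero_le_two (by positivity), ← Real.rpow_mul hNa.le, Real.div_rpow hN.le ha.le,
      show 1 / (2 / θ) = θ / 2 by field_simp,
      show 2 / (2 - θ) * (θ / 2) = 2 / (2 - θ) - 1 by field_simp; ring,
      show 2 - 2 / (2 - θ) = 1 - (2 / (2 - θ) - 1) by ring, Real.rpow_sub hN 1, Real.rpow_one]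
    field_simp
  rw [e2, add_mul, ← e1]
  ring

/-- The one-dimensional Hardy-Littlewood-Sobolev inequality, diagonal case. -/
lemma lintegral_hardy_littlewood_sobolev {θ : ℝ} (hθ : 0 < θ) (hθ1 : θ < 1) {f : ℝ → ENNReal}
    (hf : Measurable f) (hfin : ∀ t, f t ≠ ⊤) :
    ∫⁻ t, ∫⁻ s, f t * f s * ENNReal.ofReal (|t - s| ^ (-θ)) ≤
      ENNReal.ofReal (2 * (2 / (1 - θ) + 2 ^ (θ / 2))) *
        (∫⁻ t, f t ^ (2 / (2 - θ))) ^ (2 - θ) := by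
  have hp : 0 < 2 / (2 - θ) := div_pos two_pos (by linarith)
  have hC : 0 < 2 / (1 - θ) + 2 ^ (θ / 2) := by
    have : 0 < 1 - θ := by linarith
    positivity
  set Q := ∫⁻ t, f t ^ (2 / (2 - θ)) with hQ
  rcases eq_or_ne Q 0 with h0 | h0
  · have hz : ∀ᵐ s, f s = 0 := by
      have := (lintegral_eq_zero_iff (hf.pow_const _)).1 h0
      filter_upwards [this] with s hs
      exact (ENNReal.rpow_eq_zero_iff_of_pos hp).1 hs
    have : ∀ t, ∫⁻ s, f t * f s * ENNReal.ofReal (|t - s| ^ (-θ)) = 0 := by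
      intro t
      rw [lintegral_congr_ae (g := fun _ => 0), lintegral_zero]
      filter_upwards [hz] with s hs
      rw [hs, mul_zero, zero_mul]
    simp [this]
  rcases eq_or_ne Q ⊤ with htop | htop
  · rw [htop, ENNReal.top_rpow_of_pos (by linarith), ENNReal.mul_top]
    · exact le_top
    · simpa using hC
  set N : ℝ := (Q ^ (1 / (2 / (2 - θ)))).toReal with hN
  have hQfin : Q ^ (1 / (2 / (2 - θ))) ≠ ⊤ := ENNReal.rpow_ne_top_of_nonneg (by positivity) htop
  have hN0 : 0 < N := ENNReal.toReal_pos (by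
    rw [Ne, ENNReal.rpow_eq_zero_iff_of_pos (by positivity)]; exact h0) hQfin
  have hNQ : ENNReal.ofReal N = Q ^ (1 / (2 / (2 - θ))) := ENNReal.ofReal_toReal hQfin
  have hpt : ∀ t, f t * ∫⁻ s, (if f s ≤ f t then f s * ENNReal.ofReal (|t - s| ^ (-θ)) else 0) ≤
      ENNReal.ofReal ((2 / (1 - θ) + 2 ^ (θ / 2)) * N ^ (2 - 2 / (2 - θ))) * f t ^ (2 / (2 - θ)) := by
    intro t
    rcases eq_or_ne (f t) 0 with hft | hft
    · rw [hft, zero_mul]; exact zero_le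
    set a := (f t).toReal with ha
    have ha0 : 0 < a := ENNReal.toReal_pos hft (hfin t)
    have hfa : f t = ENNReal.ofReal a := (ENNReal.ofReal_toReal (hfin t)).symm
    have hρ : 0 < (N / a) ^ (2 / (2 - θ)) := by positivity
    have h1θ : 0 < 1 - θ := by linarith
    have h := lintegral_cutoff_le_of_pos hθ hθ1 hρ hf t
    rw [← hQ, ← hNQ] at h
    generalize (∫⁻ s, if f s ≤ f t then f s * ENNReal.ofReal (|t - s| ^ (-θ)) else 0) = J at h ⊢
    rw [hfa] at h
    rw [ENNReal.ofReal_rpow_of_nonneg (by positivity) (by positivity), ← ENNReal.ofReal_mul (by positivity),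
      ← ENNReal.ofReal_mul (by positivity), ← ENNReal.ofReal_add (by positivity) (by positivity),
      cutoff_bound_eq hθ hθ1 hN0 ha0] at h
    calc _ ≤ f t * _ := mul_le_mul_right h _
      _ = _ := by
        rw [hfa, ENNReal.ofReal_rpow_of_pos ha0, ← ENNReal.ofReal_mul (by positivity),
          ← ENNReal.ofReal_mul (by positivity)]
        congr 1
        rw [Real.rpow_sub_one ha0.ne']
        field_simp
  have hker : Measurable fun w : ℝ × ℝ => ENNReal.ofReal (|w.1 - w.2| ^ (-θ)) := by fun_prop
  have hset : MeasurableSet {w : ℝ × ℝ | f w.2 ≤ f w.1} :=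
    measurableSet_le (hf.comp measurable_snd) (hf.comp measurable_fst)
  set H : ℝ → ℝ → ENNReal := fun t s =>
    if f s ≤ f t then f t * f s * ENNReal.ofReal (|t - s| ^ (-θ)) else 0 with hH
  have hHm : Measurable (Function.uncurry H) := by
    refine Measurable.ite hset ?_ measurable_const
    exact ((hf.comp measurable_fst).mul (hf.comp measurable_snd)).mul hker
  have hHint : ∫⁻ t, ∫⁻ s, H t s ≤
      ENNReal.ofReal ((2 / (1 - θ) + 2 ^ (θ / 2)) * N ^ (2 - 2 / (2 - θ))) * Q := by
    rw [hQ, ← lintegral_const_mul _ (hf.pow_const _)]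
    refine lintegral_mono fun t => ?_
    refine le_trans (le_of_eq ?_) (hpt t)
    have hm : Measurable fun s => if f s ≤ f t then f s * ENNReal.ofReal (|t - s| ^ (-θ)) else 0 := by
      refine Measurable.ite (measurableSet_le hf measurable_const) ?_ measurable_const
      exact hf.mul (by fun_prop)
    rw [← lintegral_const_mul _ hm]
    congr 1
    ext s
    simp only [hH, mul_ite, mul_zero, mul_assoc]
  calc _ ≤ ∫⁻ t, ∫⁻ s, (H t s + H s t) := by
        refine lintegral_mono fun t => lintegral_mono fun s => ?_
        simp only [hH]
        rcases le_total (f s) (f t) with h | h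
        · rw [if_pos h]; exact le_self_add
        · rw [if_pos h, abs_sub_comm, mul_comm (f t)]; exact le_add_self
    _ = (∫⁻ t, ∫⁻ s, H t s) + ∫⁻ t, ∫⁻ s, H s t := by
        rw [← lintegral_add_left (f := fun t => ∫⁻ s, H t s) hHm.lintegral_prod_right']
        congr 1
        ext t
        exact lintegral_add_left (hHm.comp (by fun_prop : Measurable fun s : ℝ => (t, s))) _
    _ = 2 * ∫⁻ t, ∫⁻ s, H t s := by
        rw [lintegral_lintegral_swap (f := fun t s => H s t)
          (hHm.comp measurable_swap).aemeasurable, two_mul]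
    _ ≤ 2 * (ENNReal.ofReal ((2 / (1 - θ) + 2 ^ (θ / 2)) * N ^ (2 - 2 / (2 - θ))) * Q) := by gcongr
    _ = _ := by
        have hQN : Q = ENNReal.ofReal (N ^ (2 / (2 - θ))) := by
          rw [← ENNReal.ofReal_rpow_of_pos hN0, hNQ, ← ENNReal.rpow_mul, one_div,
            inv_mul_cancel₀ hp.ne', ENNReal.rpow_one]
        have hQ2 : Q ^ (2 - θ) = ENNReal.ofReal (N ^ (2 : ℝ)) := by
          rw [hQN, ENNReal.ofReal_rpow_of_nonneg (by positivity) (by linarith), ← Real.rpow_mul hN0.le]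
          congr 2
          have : 2 - θ ≠ 0 := by linarith
          field_simp
        rw [hQ2, hQN, ← ENNReal.ofReal_mul (by positivity), ← ENNReal.ofReal_mul (by positivity),
          ← ENNReal.ofReal_ofNat 2, ← ENNReal.ofReal_mul (by positivity)]
        congr 1
        rw [mul_assoc, ← Real.rpow_add hN0, sub_add_cancel]
        ring

lemma lintegral_le_of_tendsto_of_le {X : Type*} [MeasurableSpace X] {μ : Measure X}
    {u : ℕ → X → ENNReal} {g : X → ENNReal} {C : ENNReal} (hu : ∀ n, AEMeasurable (u n) μ)
    (hlim : ∀ᵐ x ∂μ, Filter.Tendsto (fun n => u n x) Filter.atTop (nhds (g x)))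
    (hC : ∀ n, ∫⁻ x, u n x ∂μ ≤ C) : ∫⁻ x, g x ∂μ ≤ C := by
  calc ∫⁻ x, g x ∂μ = ∫⁻ x, Filter.liminf (fun n => u n x) Filter.atTop ∂μ :=
        lintegral_congr_ae (hlim.mono fun x hx => hx.liminf_eq.symm)
    _ ≤ Filter.liminf (fun n => ∫⁻ x, u n x ∂μ) Filter.atTop := lintegral_liminf_le' hu
    _ ≤ Filter.liminf (fun _ : ℕ => C) Filter.atTop :=
        Filter.liminf_le_liminf (Filter.Eventually.of_forall hC)
    _ = C := Filter.liminf_const C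

lemma ae_fst_ne_zero : ∀ᵐ p : ℝ × ℝ, p.1 ≠ 0 := by
  have h : ∀ᵐ x : ℝ, x ≠ 0 := by simp [ae_iff]
  exact (Measure.quasiMeasurePreserving_fst (μ := (volume : Measure ℝ)) (ν := (volume : Measure ℝ))).ae h

lemma truncatedSymbol_ofReal (κ ε R δ θ : ℝ) (p : ℝ × ℝ) :
    truncatedSymbol κ ε R δ θ p = ((‖truncatedSymbol κ ε R δ θ p‖ : ℝ) : ℂ) := by
  rw [norm_truncatedSymbol]
  unfold truncatedSymbol
  split_ifs
  · conv_rhs => rw [Complex.ofReal_mul, Complex.ofReal_exp]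
    congr 2
    simp
    ring
  · simp

lemma tendsto_enorm_truncatedSymbol (κ θ : ℝ) {p : ℝ × ℝ} (hp : p.1 ≠ 0) :
    Filter.Tendsto (fun n : ℕ => ‖truncatedSymbol κ (1 / ((n : ℝ) + 1)) ((n : ℝ) + 1) (1 / ((n : ℝ) + 1)) θ p‖ₑ)
      Filter.atTop (nhds (ENNReal.ofReal (|p.1| ^ (-(κ * θ))))) := by
  have hp0 : 0 < |p.1| := abs_pos.2 hp
  have h1 : Filter.Tendsto (fun n : ℕ => 1 / ((n : ℝ) + 1)) Filter.atTop (nhds 0) :=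
    tendsto_one_div_add_atTop_nhds_zero_nat
  have h2 : ∀ᶠ n : ℕ in Filter.atTop, 1 / ((n : ℝ) + 1) < |p.1| := h1.eventually_lt_const hp0
  have h3 : ∀ᶠ n : ℕ in Filter.atTop, |p.1| < (n : ℝ) + 1 := by
    filter_upwards [tendsto_natCast_atTop_atTop.eventually_gt_atTop |p.1|] with n hn
    linarith
  have h4 : Filter.Tendsto (fun n : ℕ => Real.exp (-(κ * θ) * Real.log |p.1|) *
      Real.exp (-((1 / ((n : ℝ) + 1)) * (p.2 ^ 2 / |p.1|)))) Filter.atTop (nhds (|p.1| ^ (-(κ * θ)))) := by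
    have h5 := (Real.continuous_exp.tendsto 0).comp ((h1.mul_const (p.2 ^ 2 / |p.1|)).neg.trans_eq
      (by rw [zero_mul, neg_zero]))
    have h6 := h5.const_mul (Real.exp (-(κ * θ) * Real.log |p.1|))
    rw [Real.exp_zero, mul_one] at h6
    rw [Real.rpow_def_of_pos hp0, mul_comm (Real.log _)]
    exact h6
  refine (ENNReal.tendsto_ofReal h4).congr' ?_
  filter_upwards [h2, h3] with n hn2 hn3
  rw [← ofReal_norm, norm_truncatedSymbol, if_pos ⟨hn2, hn3⟩, Complex.ofReal_re]

/-- The adjoint of the propagator. -/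
noncomputable def spacetimeAdjoint (α : ℝ) (F : ℝ → ℝ × ℝ → ℂ) (p : ℝ × ℝ) : ℂ :=
  ∫ t : ℝ, Complex.exp (-I * ((t * kpPhase α p : ℝ) : ℂ)) * planeFourier (F t) p

/-- The `L^{2/(1+θ)}` norm of each time slice. -/
noncomputable def sliceNorm (θ : ℝ) (F : ℝ → ℝ × ℝ → ℂ) (t : ℝ) : ℝ :=
  (∫ x, ‖F t x‖ ^ (2 / (1 + θ))) ^ ((1 + θ) / 2)

section Adjoint

variable {F : ℝ → ℝ × ℝ → ℂ}

lemma sliceNorm_nonneg (θ : ℝ) (F : ℝ → ℝ × ℝ → ℂ) (t : ℝ) : 0 ≤ sliceNorm θ F t :=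
  Real.rpow_nonneg (integral_nonneg fun _ => by positivity) _

lemma measurable_sliceNorm (θ : ℝ) (hF : Measurable (Function.uncurry F)) :
    Measurable (sliceNorm θ F) := by
  have h : StronglyMeasurable (Function.uncurry fun t x => ‖F t x‖ ^ (2 / (1 + θ))) :=
    (hF.norm.pow_const (2 / (1 + θ))).stronglyMeasurable
  exact (h.integral_prod_right (ν := volume)).measurable.pow_const _

lemma measurable_uncurry_adjoint (α : ℝ) (hF : Measurable (Function.uncurry F)) :
    Measurable (Function.uncurry fun t p =>
      Complex.exp (-I * ((t * kpPhase α p : ℝ) : ℂ)) * planeFourier (F t) p) := by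
  have h1 : Measurable fun w : (ℝ × (ℝ × ℝ)) × (ℝ × ℝ) =>
      Complex.exp (-I * (planePairing w.2 w.1.2 : ℂ)) * F w.1.1 w.2 := by
    have e1 : Measurable fun w : (ℝ × (ℝ × ℝ)) × (ℝ × ℝ) => F w.1.1 w.2 :=
      hF.comp (f := fun w : (ℝ × (ℝ × ℝ)) × (ℝ × ℝ) => (w.1.1, w.2)) (by fun_prop)
    unfold planePairing
    fun_prop
  have h2 : StronglyMeasurable (fun v : ℝ × (ℝ × ℝ) =>
      ∫ x, Complex.exp (-I * (planePairing x v.2 : ℂ)) * F v.1 x) :=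
    StronglyMeasurable.integral_prod_right (ν := volume) (f := fun (v : ℝ × (ℝ × ℝ)) (x : ℝ × ℝ) =>
      Complex.exp (-I * (planePairing x v.2 : ℂ)) * F v.1 x) h1.stronglyMeasurable
  have h3 : Measurable fun v : ℝ × (ℝ × ℝ) => Complex.exp (-I * ((v.1 * kpPhase α v.2 : ℝ) : ℂ)) := by
    have := measurable_kpPhase α
    fun_prop
  exact h3.mul h2.measurable

lemma norm_adjoint_slice_le (α : ℝ) (t : ℝ) (p : ℝ × ℝ) :
    ‖Complex.exp (-I * ((t * kpPhase α p : ℝ) : ℂ)) * planeFourier (F t) p‖ ≤ ∫ x, ‖F t x‖ := by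
  rw [norm_mul, norm_exp_neg_I_mul, one_mul]
  exact norm_planeFourier_le _ _

lemma measurable_spacetimeAdjoint (α : ℝ) (hF : Measurable (Function.uncurry F)) :
    Measurable (spacetimeAdjoint α F) := by
  have h := (measurable_uncurry_adjoint α hF).comp measurable_swap
  have h2 : StronglyMeasurable (fun p : ℝ × ℝ =>
      ∫ t : ℝ, Complex.exp (-I * ((t * kpPhase α p : ℝ) : ℂ)) * planeFourier (F t) p) :=
    StronglyMeasurable.integral_prod_right (ν := volume) (f := fun (p : ℝ × ℝ) (t : ℝ) =>
      Complex.exp (-I * ((t * kpPhase α p : ℝ) : ℂ)) * planeFourier (F t) p) h.stronglyMeasurable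
  exact h2.measurable

lemma norm_spacetimeAdjoint_le (α : ℝ) (hFi : Integrable (Function.uncurry F)) (p : ℝ × ℝ) :
    ‖spacetimeAdjoint α F p‖ ≤ ∫ t, ∫ x, ‖F t x‖ := by
  unfold spacetimeAdjoint
  have hA : Integrable fun t => ∫ x, ‖F t x‖ := hFi.integral_norm_prod_left
  exact norm_integral_le_of_norm_le hA (ae_of_all _ fun t => norm_adjoint_slice_le α t p)

lemma IsSimpleLike.conj {f : ℝ × ℝ → ℂ} (hf : IsSimpleLike f) :
    IsSimpleLike fun x => (starRingEnd ℂ) (f x) := by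
  obtain ⟨h1, h2, h3⟩ := hf
  refine ⟨Complex.continuous_conj.measurable.comp h1, by simpa only [RCLike.norm_conj] using h2, ?_⟩
  have : Function.support (fun x => (starRingEnd ℂ) (f x)) = Function.support f := by
    ext x
    simp
  rwa [this]

lemma lintegral_truncatedSymbol_mul_spacetimeAdjoint_le {α ε R δ θ : ℝ} (hα : 1 < α) (hε : 0 < ε)
    (hR : ε ≤ R) (hδ : 0 < δ) (hθ : 0 < θ) (hθ1 : θ < 1) (hF : Measurable (Function.uncurry F))
    (hFi : Integrable (Function.uncurry F)) (hFs : ∀ t, IsSimpleLike (F t)) :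
    ∫⁻ p, ‖truncatedSymbol (1 - α / 2) ε R δ θ p‖ₑ * ‖spacetimeAdjoint α F p‖ₑ ^ 2 ≤
      ENNReal.ofReal (decayConst α θ) * (ENNReal.ofReal (2 * (2 / (1 - θ) + 2 ^ (θ / 2))) *
        (∫⁻ t, ENNReal.ofReal (sliceNorm θ F t) ^ (2 / (2 - θ))) ^ (2 - θ)) := by
  set S := truncatedSymbol (1 - α / 2) ε R δ θ with hS
  have hSi : Integrable S := integrable_truncatedSymbol hε hδ _
  set a : ℝ → ℝ × ℝ → ℂ := fun t p =>
    Complex.exp (-I * ((t * kpPhase α p : ℝ) : ℂ)) * planeFourier (F t) p with ha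
  have ham : Measurable (Function.uncurry a) := measurable_uncurry_adjoint α hF
  set b : ℝ → ℝ × ℝ → ℂ := fun t p => (starRingEnd ℂ) (a t p) with hb
  have hbm : Measurable (Function.uncurry b) := Complex.continuous_conj.measurable.comp ham
  have hA : Integrable fun t => ∫ x, ‖F t x‖ := hFi.integral_norm_prod_left
  have hFub := integral_mul_bilinear hSi ham hbm hA hA (fun t p => norm_adjoint_slice_le α t p)
    (fun t p => by rw [hb]; simp only [RCLike.norm_conj]; exact norm_adjoint_slice_le α t p)
  have hin : ∀ w : ℝ × ℝ, ∫ p, S p * (a w.1 p * b w.2 p) =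
      truncatedForm (1 - α / 2) α ε R δ (w.1 - w.2) θ (F w.1) (fun x => (starRingEnd ℂ) (F w.2 x)) := by
    intro w
    unfold truncatedForm
    congr 1
    ext p
    simp only [hb, ha, map_mul]
    rw [conj_planeFourier, ← Complex.exp_conj]
    have : Complex.exp (-I * (((w.1 - w.2) * kpPhase α p : ℝ) : ℂ)) =
        Complex.exp (-I * ((w.1 * kpPhase α p : ℝ) : ℂ)) *
          Complex.exp ((starRingEnd ℂ) (-I * ((w.2 * kpPhase α p : ℝ) : ℂ))) := by
      rw [← Complex.exp_add]
      congr 1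
      simp
      ring
    rw [this]
    ring
  simp_rw [hin] at hFub
  have hlhs : ∫⁻ p, ‖S p‖ₑ * ‖spacetimeAdjoint α F p‖ₑ ^ 2 =
      ‖∫ p, S p * ((∫ t, a t p) * ∫ t, b t p)‖ₑ := by
    have e1 : ∀ p, S p * ((∫ t, a t p) * ∫ t, b t p) =
        ((‖S p‖ * ‖spacetimeAdjoint α F p‖ ^ 2 : ℝ) : ℂ) := by
      intro p
      simp only [hb]
      rw [integral_conj, Complex.mul_conj', hS, truncatedSymbol_ofReal]
      push_cast
      rw [Complex.norm_real, norm_norm]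
      rfl
    have hint : Integrable fun p => ‖S p‖ * ‖spacetimeAdjoint α F p‖ ^ 2 := by
      refine hSi.norm.mul_bdd (c := (∫ t, ∫ x, ‖F t x‖) ^ 2) ?_ (ae_of_all _ fun p => ?_)
      · exact ((measurable_spacetimeAdjoint α hF).norm.pow_const 2).aestronglyMeasurable
      · rw [norm_pow, norm_norm]
        gcongr
        exact norm_spacetimeAdjoint_le α hFi p
    simp_rw [e1]
    rw [integral_complex_ofReal, ← ofReal_norm, Complex.norm_real, Real.norm_eq_abs,
      abs_of_nonneg (integral_nonneg fun p => by positivity),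
      ofReal_integral_eq_lintegral_ofReal hint (ae_of_all _ fun p => by positivity)]
    congr 1
    ext p
    rw [ENNReal.ofReal_mul (norm_nonneg _), ENNReal.ofReal_pow (norm_nonneg _), ofReal_norm, ofReal_norm]
  rw [hlhs, hFub]
  have hNm : Measurable fun t => ENNReal.ofReal (sliceNorm θ F t) :=
    (measurable_sliceNorm θ hF).ennreal_ofReal
  have hK : Measurable fun w : ℝ × ℝ => ENNReal.ofReal (|w.1 - w.2| ^ (-θ)) := by fun_prop
  have hD : 0 ≤ decayConst α θ := by unfold decayConst; positivity
  calc _ ≤ ∫⁻ w : ℝ × ℝ, ‖truncatedForm (1 - α / 2) α ε R δ (w.1 - w.2) θ (F w.1)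
          (fun x => (starRingEnd ℂ) (F w.2 x))‖ₑ ∂(volume.prod volume) :=
        enorm_integral_le_lintegral_enorm _
    _ ≤ ∫⁻ t, ∫⁻ s, ‖truncatedForm (1 - α / 2) α ε R δ (t - s) θ (F t)
          (fun x => (starRingEnd ℂ) (F s x))‖ₑ :=
        lintegral_prod_le (fun w : ℝ × ℝ => ‖truncatedForm (1 - α / 2) α ε R δ (w.1 - w.2) θ (F w.1)
          (fun x => (starRingEnd ℂ) (F w.2 x))‖ₑ)
    _ ≤ ∫⁻ t, ∫⁻ s, ENNReal.ofReal (decayConst α θ) * (ENNReal.ofReal (sliceNorm θ F t) *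
          ENNReal.ofReal (sliceNorm θ F s) * ENNReal.ofReal (|t - s| ^ (-θ))) := by
        refine lintegral_mono fun t => lintegral_mono_ae ?_
        have hne : ∀ᵐ s : ℝ, s ≠ t := by simp [ae_iff]
        filter_upwards [hne] with s hs
        have h := norm_truncatedForm_le (R := R) (t := t - s) hα hε hR hδ (sub_ne_zero.2 hs.symm) hθ hθ1
          (hFs t) (hFs s).conj
        simp only [RCLike.norm_conj] at h
        rw [← ofReal_norm, ← ENNReal.ofReal_mul (sliceNorm_nonneg _ _ _),
          ← ENNReal.ofReal_mul (mul_nonneg (sliceNorm_nonneg _ _ _) (sliceNorm_nonneg _ _ _)),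
          ← ENNReal.ofReal_mul hD]
        refine ENNReal.ofReal_le_ofReal (h.trans_eq ?_)
        unfold sliceNorm
        ring
    _ = ENNReal.ofReal (decayConst α θ) * ∫⁻ t, ∫⁻ s, ENNReal.ofReal (sliceNorm θ F t) *
          ENNReal.ofReal (sliceNorm θ F s) * ENNReal.ofReal (|t - s| ^ (-θ)) := by
        have hm : Measurable fun w : ℝ × ℝ => ENNReal.ofReal (sliceNorm θ F w.1) *
          ENNReal.ofReal (sliceNorm θ F w.2) * ENNReal.ofReal (|w.1 - w.2| ^ (-θ)) :=
          ((hNm.comp measurable_fst).mul (hNm.comp measurable_snd)).mul hK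
        rw [← lintegral_const_mul _ hm.lintegral_prod_right']
        congr 1
        ext t
        have h1 : Measurable fun s => ENNReal.ofReal (|t - s| ^ (-θ)) := by fun_prop
        exact lintegral_const_mul _ ((hNm.const_mul _).mul h1)
    _ ≤ _ := by
        refine mul_le_mul_right ?_ _
        exact lintegral_hardy_littlewood_sobolev hθ hθ1 hNm fun t => ENNReal.ofReal_ne_top

/-- The constant in the dual Strichartz estimate. -/
noncomputable def dualConst (α θ : ℝ) : ENNReal :=
  ENNReal.ofReal (decayConst α θ) * ENNReal.ofReal (2 * (2 / (1 - θ) + 2 ^ (θ / 2)))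

/-- The dual Strichartz estimate. -/
lemma lintegral_spacetimeAdjoint_le {α θ : ℝ} (hα : 1 < α) (hθ : 0 < θ) (hθ1 : θ < 1)
    (hF : Measurable (Function.uncurry F)) (hFi : Integrable (Function.uncurry F))
    (hFs : ∀ t, IsSimpleLike (F t)) :
    ∫⁻ p, ENNReal.ofReal (|p.1| ^ (-((1 - α / 2) * θ))) * ‖spacetimeAdjoint α F p‖ₑ ^ 2 ≤
      dualConst α θ * (∫⁻ t, ENNReal.ofReal (sliceNorm θ F t) ^ (2 / (2 - θ))) ^ (2 - θ) := by
  have hm := measurable_spacetimeAdjoint α hF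
  refine lintegral_le_of_tendsto_of_le (u := fun (n : ℕ) p => ‖truncatedSymbol (1 - α / 2)
    (1 / ((n : ℝ) + 1)) ((n : ℝ) + 1) (1 / ((n : ℝ) + 1)) θ p‖ₑ * ‖spacetimeAdjoint α F p‖ₑ ^ 2)
    (fun n => ?_) ?_ (fun n => ?_)
  · have := measurable_truncatedSymbol (1 - α / 2) (1 / ((n : ℝ) + 1)) ((n : ℝ) + 1) (1 / ((n : ℝ) + 1)) θ
    fun_prop
  · filter_upwards [ae_fst_ne_zero] with p hp
    refine ENNReal.Tendsto.mul_const (tendsto_enorm_truncatedSymbol _ _ hp) (Or.inr ?_)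
    exact ENNReal.pow_ne_top enorm_ne_top
  · rw [dualConst, mul_assoc]
    have h1 : (1 : ℝ) ≤ (n : ℝ) + 1 := by have := n.cast_nonneg (α := ℝ); linarith
    refine lintegral_truncatedSymbol_mul_spacetimeAdjoint_le hα (by positivity) ?_ (by positivity) hθ hθ1
      hF hFi hFs
    exact (div_le_one_of_le₀ h1 (by positivity)).trans h1

end Adjoint

/-- Measurable space-time functions, bounded above and below off their zero set and supported in a
bounded box. -/
def IsTame (v : ℝ → ℝ × ℝ → ℂ) (m M L : ℝ) : Prop :=
  Measurable (Function.uncurry v) ∧ 0 < m ∧ 0 < L ∧ ∀ t z, v t z ≠ 0 →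
    m ≤ ‖v t z‖ ∧ ‖v t z‖ ≤ M ∧ |t| ≤ L ∧ |z.1| ≤ L ∧ |z.2| ≤ L

/-- The function extremising the duality pairing with `v`. -/
noncomputable def dualizer (θ : ℝ) (v : ℝ → ℝ × ℝ → ℂ) (t : ℝ) (z : ℝ × ℝ) : ℂ :=
  v t z * ((‖v t z‖ ^ (2 / (1 - θ) - 2) * (∫ x, ‖v t x‖ ^ (2 / (1 - θ))) ^ ((1 - θ) / θ - 1) : ℝ) : ℂ)

section Tame

variable {v : ℝ → ℝ × ℝ → ℂ} {m M L θ : ℝ}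

lemma IsTame.measurable_slice (hv : IsTame v m M L) (t : ℝ) : Measurable (v t) :=
  hv.1.comp (by fun_prop : Measurable fun z : ℝ × ℝ => (t, z))

lemma volume_box (L : ℝ) (hL : 0 ≤ L) :
    volume (Set.Icc (-L) L ×ˢ Set.Icc (-L) L : Set (ℝ × ℝ)) = ENNReal.ofReal ((2 * L) ^ 2) := by
  rw [Measure.volume_eq_prod, Measure.prod_prod, Real.volume_Icc, ← ENNReal.ofReal_mul (by linarith)]
  congr 1
  ring

lemma IsTame.support_subset (hv : IsTame v m M L) (t : ℝ) :
    Function.support (v t) ⊆ Set.Icc (-L) L ×ˢ Set.Icc (-L) L := by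
  intro z hz
  obtain ⟨-, -, -, h1, h2⟩ := hv.2.2.2 t z hz
  exact ⟨abs_le.1 h1, abs_le.1 h2⟩

lemma IsTame.volume_support_lt_top (hv : IsTame v m M L) (t : ℝ) :
    volume (Function.support (v t)) < ⊤ :=
  (measure_mono (hv.support_subset t)).trans_lt (by
    rw [volume_box L hv.2.2.1.le]; exact ENNReal.ofReal_lt_top)

lemma IsTame.abs_log_le (hv : IsTame v m M L) (t : ℝ) (z : ℝ × ℝ) :
    |Real.log ‖v t z‖| ≤ |Real.log m| + |Real.log M| := by
  rcases eq_or_ne (v t z) 0 with h | h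
  · rw [h, norm_zero, Real.log_zero, abs_zero]; positivity
  · obtain ⟨h1, h2, -⟩ := hv.2.2.2 t z h
    have a1 := Real.log_le_log hv.2.1 h1
    have a2 := Real.log_le_log (norm_pos_iff.2 h) h2
    rw [abs_le]
    have := neg_abs_le (Real.log m)
    have := le_abs_self (Real.log M)
    have := abs_nonneg (Real.log m)
    have := abs_nonneg (Real.log M)
    constructor <;> linarith

lemma IsTame.isSimpleLike (hv : IsTame v m M L) (t : ℝ) : IsSimpleLike (v t) :=
  ⟨hv.measurable_slice t, ⟨_, hv.abs_log_le t⟩, hv.volume_support_lt_top t⟩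

lemma measurable_mass (hv : IsTame v m M L) (s : ℝ) : Measurable fun t => ∫ x, ‖v t x‖ ^ s := by
  have h : StronglyMeasurable (Function.uncurry fun t x => ‖v t x‖ ^ s) :=
    (hv.1.norm.pow_const s).stronglyMeasurable
  exact (h.integral_prod_right (ν := volume)).measurable

lemma mass_nonneg (v : ℝ → ℝ × ℝ → ℂ) (s t : ℝ) : 0 ≤ ∫ x, ‖v t x‖ ^ s :=
  integral_nonneg fun _ => by positivity

lemma IsTame.mass_le (hv : IsTame v m M L) {s : ℝ} (hs : 0 < s) (t : ℝ) :
    ∫ x, ‖v t x‖ ^ s ≤ if |t| ≤ L then |M| ^ s * (2 * L) ^ 2 else 0 := by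
  split_ifs with ht
  · have hbox : MeasurableSet (Set.Icc (-L) L ×ˢ Set.Icc (-L) L : Set (ℝ × ℝ)) :=
      measurableSet_Icc.prod measurableSet_Icc
    have hfin : volume (Set.Icc (-L) L ×ˢ Set.Icc (-L) L : Set (ℝ × ℝ)) ≠ ⊤ := by
      rw [volume_box L hv.2.2.1.le]; exact ENNReal.ofReal_ne_top
    have hi : Integrable ((Set.Icc (-L) L ×ˢ Set.Icc (-L) L : Set (ℝ × ℝ)).indicator
        fun _ => |M| ^ s) := by
      rw [integrable_indicator_iff hbox]
      exact integrableOn_const hfin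
    have h : ∫ x, ‖v t x‖ ^ s ≤ ∫ x, (Set.Icc (-L) L ×ˢ Set.Icc (-L) L : Set (ℝ × ℝ)).indicator
        (fun _ => |M| ^ s) x := by
      refine integral_mono ((hv.isSimpleLike t).integrable_rpow hs) hi fun x => ?_
      rcases eq_or_ne (v t x) 0 with h | h
      · simp only [h, norm_zero, Real.zero_rpow hs.ne']
        exact Set.indicator_nonneg (fun _ _ => by positivity) _
      · rw [Set.indicator_of_mem (hv.support_subset t h)]
        have h1 := (hv.2.2.2 t x h).2.1.trans (le_abs_self M)
        simp only
        gcongr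
    refine h.trans_eq ?_
    rw [integral_indicator hbox, setIntegral_const, measureReal_def, volume_box L hv.2.2.1.le,
      ENNReal.toReal_ofReal (by positivity), smul_eq_mul, mul_comm]
  · have : ∀ x, v t x = 0 := by
      intro x
      by_contra h
      exact ht (hv.2.2.2 t x h).2.2.1
    simp [this, Real.zero_rpow hs.ne']

lemma measurable_dualizer (hv : IsTame v m M L) : Measurable (Function.uncurry (dualizer θ v)) := by
  have h1 := hv.1
  have h2 : Measurable fun w : ℝ × (ℝ × ℝ) =>
      ‖Function.uncurry v w‖ ^ (2 / (1 - θ) - 2) *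
        (∫ x, ‖v w.1 x‖ ^ (2 / (1 - θ))) ^ ((1 - θ) / θ - 1) :=
    (h1.norm.pow_const _).mul (((measurable_mass hv _).comp measurable_fst).pow_const _)
  exact h1.mul (Complex.measurable_ofReal.comp h2)

lemma norm_dualizer (hθ : 0 < θ) (hθ1 : θ < 1) (v : ℝ → ℝ × ℝ → ℂ) (t : ℝ) (z : ℝ × ℝ) :
    ‖dualizer θ v t z‖ = ‖v t z‖ ^ (2 / (1 - θ) - 1) *
      (∫ x, ‖v t x‖ ^ (2 / (1 - θ))) ^ ((1 - θ) / θ - 1) := by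
  have h2 : 2 < 2 / (1 - θ) := by rw [lt_div_iff₀ (by linarith)]; linarith
  have hW := Real.rpow_nonneg (mass_nonneg v (2 / (1 - θ)) t) ((1 - θ) / θ - 1)
  unfold dualizer
  rw [norm_mul, Complex.norm_real, Real.norm_eq_abs, abs_of_nonneg (by positivity), ← mul_assoc]
  congr 1
  rcases eq_or_ne (v t z) 0 with h | h
  · rw [h, norm_zero, zero_mul, Real.zero_rpow (by linarith)]
  · have hp := norm_pos_iff.2 h
    nth_rewrite 1 [← Real.rpow_one ‖v t z‖]
    rw [← Real.rpow_add hp]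
    congr 1
    ring

lemma abs_log_mul_le (a b : ℝ) : |Real.log (a * b)| ≤ |Real.log a| + |Real.log b| := by
  rcases eq_or_ne a 0 with h | h
  · rw [h, zero_mul, Real.log_zero, abs_zero]; positivity
  rcases eq_or_ne b 0 with h' | h'
  · rw [h', mul_zero, Real.log_zero, abs_zero]; positivity
  rw [Real.log_mul h h']
  exact abs_add_le _ _

lemma isSimpleLike_dualizer (hθ : 0 < θ) (hθ1 : θ < 1) (hv : IsTame v m M L) (t : ℝ) :
    IsSimpleLike (dualizer θ v t) := by
  have h2 : 2 < 2 / (1 - θ) := by rw [lt_div_iff₀ (by linarith)]; linarith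
  refine ⟨(measurable_dualizer hv).comp (by fun_prop : Measurable fun z : ℝ × ℝ => (t, z)),
    ⟨(2 / (1 - θ) - 1) * (|Real.log m| + |Real.log M|) +
      |Real.log ((∫ x, ‖v t x‖ ^ (2 / (1 - θ))) ^ ((1 - θ) / θ - 1))|, fun z => ?_⟩, ?_⟩
  · rw [norm_dualizer hθ hθ1]
    refine (abs_log_mul_le _ _).trans (add_le_add ?_ le_rfl)
    rcases eq_or_ne (v t z) 0 with h | h
    · rw [h, norm_zero, Real.zero_rpow (by linarith), Real.log_zero, abs_zero]
      have : 0 ≤ 2 / (1 - θ) - 1 := by linarith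
      positivity
    · rw [Real.log_rpow (norm_pos_iff.2 h), abs_mul, abs_of_nonneg (by linarith : 0 ≤ 2 / (1 - θ) - 1)]
      have := hv.abs_log_le t z
      have : 0 ≤ 2 / (1 - θ) - 1 := by linarith
      gcongr
  · refine (measure_mono fun z hz => ?_).trans_lt (hv.volume_support_lt_top t)
    intro h
    apply hz
    simp [dualizer, h]

lemma IsSimpleLike.integrable {f : ℝ × ℝ → ℂ} (hf : IsSimpleLike f) : Integrable f := by
  rw [← integrable_norm_iff hf.1.aestronglyMeasurable]
  simpa using hf.integrable_rpow one_pos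

lemma mass_mul_rpow (hθ : 0 < θ) (hθ1 : θ < 1) (v : ℝ → ℝ × ℝ → ℂ) (t : ℝ) :
    (∫ x, ‖v t x‖ ^ (2 / (1 - θ))) * (∫ x, ‖v t x‖ ^ (2 / (1 - θ))) ^ ((1 - θ) / θ - 1) =
      (∫ x, ‖v t x‖ ^ (2 / (1 - θ))) ^ ((1 - θ) / θ) := by
  have hb : 0 < (1 - θ) / θ := div_pos (by linarith) hθ
  rcases (mass_nonneg v (2 / (1 - θ)) t).eq_or_lt with h | h
  · rw [← h, zero_mul, Real.zero_rpow hb.ne']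
  · rw [Real.rpow_sub_one h.ne']
    field_simp

lemma integrable_dualizer (hθ : 0 < θ) (hθ1 : θ < 1) (hv : IsTame v m M L) :
    Integrable (Function.uncurry (dualizer θ v)) := by
  have h2 : 2 < 2 / (1 - θ) := by rw [lt_div_iff₀ (by linarith)]; linarith
  have hb : 0 < (1 - θ) / θ := div_pos (by linarith) hθ
  have hm := measurable_dualizer (θ := θ) hv
  rw [Measure.volume_eq_prod, integrable_prod_iff hm.aestronglyMeasurable]
  refine ⟨ae_of_all _ fun t => (isSimpleLike_dualizer hθ hθ1 hv t).integrable, ?_⟩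
  have hI : Integrable ((Set.Icc (-L) L).indicator fun _ : ℝ =>
      m⁻¹ * (|M| ^ (2 / (1 - θ)) * (2 * L) ^ 2) ^ ((1 - θ) / θ)) := by
    rw [integrable_indicator_iff measurableSet_Icc]
    exact integrableOn_const (by simp)
  refine hI.mono' ?_ (ae_of_all _ fun t => ?_)
  · have h : StronglyMeasurable (Function.uncurry fun t x => ‖dualizer θ v t x‖) :=
      hm.norm.stronglyMeasurable
    exact (h.integral_prod_right (ν := volume)).aestronglyMeasurable
  · rw [Real.norm_eq_abs, abs_of_nonneg (integral_nonneg fun _ => norm_nonneg _)]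
    set W := ∫ x, ‖v t x‖ ^ (2 / (1 - θ)) with hW
    have hW0 : 0 ≤ W := mass_nonneg v _ t
    have h1 : ∫ x, ‖dualizer θ v t x‖ ≤ m⁻¹ * W ^ ((1 - θ) / θ) := by
      rw [← mass_mul_rpow hθ hθ1 v t, ← hW, ← mul_assoc]
      nth_rewrite 1 [hW]
      rw [← integral_const_mul, ← integral_mul_const]
      refine integral_mono (isSimpleLike_dualizer hθ hθ1 hv t).integrable.norm
        ((((hv.isSimpleLike t).integrable_rpow (by linarith)).const_mul _).mul_const _) fun x => ?_
      simp only
      rw [norm_dualizer hθ hθ1]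
      gcongr
      rcases eq_or_ne (v t x) 0 with h | h
      · rw [h, norm_zero, Real.zero_rpow (by linarith), Real.zero_rpow (by linarith), mul_zero]
      · have hp := norm_pos_iff.2 h
        rw [Real.rpow_sub_one hp.ne', div_eq_inv_mul]
        have := (hv.2.2.2 t x h).1
        have := hv.2.1
        gcongr
    have h3 := hv.mass_le (s := 2 / (1 - θ)) (by linarith) t
    rw [← hW] at h3
    have hm0 := hv.2.1
    by_cases ht : |t| ≤ L
    · rw [if_pos ht] at h3
      rw [Set.indicator_of_mem (show t ∈ Set.Icc (-L) L from abs_le.1 ht)]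
      refine h1.trans ?_
      gcongr
    · rw [if_neg ht] at h3
      rw [le_antisymm h3 hW0, Real.zero_rpow hb.ne', mul_zero] at h1
      exact h1.trans (Set.indicator_nonneg (fun _ _ => by positivity) _)

lemma sliceNorm_dualizer (hθ : 0 < θ) (hθ1 : θ < 1) (v : ℝ → ℝ × ℝ → ℂ) (t : ℝ) :
    ENNReal.ofReal (sliceNorm θ (dualizer θ v) t) ^ (2 / (2 - θ)) =
      ENNReal.ofReal ((∫ x, ‖v t x‖ ^ (2 / (1 - θ))) ^ ((1 - θ) / θ)) := by
  have hb : 0 < (1 - θ) / θ := div_pos (by linarith) hθ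
  have hp : 0 < 2 / (2 - θ) := div_pos two_pos (by linarith)
  have h1 : 1 - θ ≠ 0 := by linarith
  have h2 : 2 - θ ≠ 0 := by linarith
  set W := ∫ x, ‖v t x‖ ^ (2 / (1 - θ)) with hW
  have hW0 : 0 ≤ W := mass_nonneg v _ t
  have e1 : ∀ x, ‖dualizer θ v t x‖ ^ (2 / (1 + θ)) =
      ‖v t x‖ ^ (2 / (1 - θ)) * (W ^ ((1 - θ) / θ - 1)) ^ (2 / (1 + θ)) := by
    intro x
    rw [norm_dualizer hθ hθ1, ← hW, Real.mul_rpow (by positivity) (by positivity),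
      ← Real.rpow_mul (norm_nonneg _)]
    congr 2
    field_simp
    ring
  rw [ENNReal.ofReal_rpow_of_nonneg (sliceNorm_nonneg _ _ _) hp.le]
  congr 1
  unfold sliceNorm
  simp_rw [e1]
  rw [integral_mul_const, ← hW]
  rcases hW0.eq_or_lt with h | h
  · rw [← h, zero_mul, Real.zero_rpow (by positivity), Real.zero_rpow hp.ne', Real.zero_rpow hb.ne']
  · rw [← Real.rpow_mul h.le, ← Real.rpow_one_add' h.le, ← Real.rpow_mul h.le, ← Real.rpow_mul h.le]
    · congr 1
      field_simp
      ring
    · have : 1 + ((1 - θ) / θ - 1) * (2 / (1 + θ)) = (2 - θ) * (1 - θ) / (θ * (1 + θ)) := by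
        field_simp
        ring
      rw [this]
      have : 0 < 1 - θ := by linarith
      have : 0 < 2 - θ := by linarith
      positivity

lemma conj_mul_dualizer (hθ : 0 < θ) (hθ1 : θ < 1) (v : ℝ → ℝ × ℝ → ℂ) (t : ℝ) (z : ℝ × ℝ) :
    (starRingEnd ℂ) (v t z) * dualizer θ v t z =
      ((‖v t z‖ ^ (2 / (1 - θ)) * (∫ x, ‖v t x‖ ^ (2 / (1 - θ))) ^ ((1 - θ) / θ - 1) : ℝ) : ℂ) := by
  have h2 : 2 < 2 / (1 - θ) := by rw [lt_div_iff₀ (by linarith)]; linarith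
  unfold dualizer
  rw [← mul_assoc, Complex.conj_mul']
  rw [← Complex.ofReal_pow, ← Complex.ofReal_mul, ← mul_assoc]
  congr 2
  rcases eq_or_ne (v t z) 0 with h | h
  · rw [h, norm_zero, Real.zero_rpow (by linarith : 2 / (1 - θ) ≠ 0)]
    simp
  · have hp := norm_pos_iff.2 h
    rw [← Real.rpow_natCast, ← Real.rpow_add hp]
    congr 1
    push_cast
    ring

end Tame

/-- The propagator applied to a function with Fourier transform `G`. -/
noncomputable def propagator (α : ℝ) (G : ℝ × ℝ → ℂ) (t : ℝ) (z : ℝ × ℝ) : ℂ :=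
  ∫ p, Complex.exp (I * (planePairing z p : ℂ)) * Complex.exp (I * ((t * kpPhase α p : ℝ) : ℂ)) * G p

lemma norm_exp_I_mul (a : ℝ) : ‖Complex.exp (I * (a : ℂ))‖ = 1 := by
  rw [mul_comm]
  exact Complex.norm_exp_ofReal_mul_I a

section Propagator

variable {G : ℝ × ℝ → ℂ}

lemma measurable_propagator (α : ℝ) (hG : Measurable G) :
    Measurable (Function.uncurry (propagator α G)) := by
  have h1 : Measurable fun w : (ℝ × (ℝ × ℝ)) × (ℝ × ℝ) =>
      Complex.exp (I * (planePairing w.1.2 w.2 : ℂ)) *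
        Complex.exp (I * ((w.1.1 * kpPhase α w.2 : ℝ) : ℂ)) * G w.2 := by
    have := measurable_kpPhase α
    unfold planePairing
    fun_prop
  have h2 : StronglyMeasurable (fun v : ℝ × (ℝ × ℝ) =>
      ∫ p, Complex.exp (I * (planePairing v.2 p : ℂ)) *
        Complex.exp (I * ((v.1 * kpPhase α p : ℝ) : ℂ)) * G p) :=
    StronglyMeasurable.integral_prod_right (ν := volume) (f := fun (v : ℝ × (ℝ × ℝ)) (p : ℝ × ℝ) =>
      Complex.exp (I * (planePairing v.2 p : ℂ)) *
        Complex.exp (I * ((v.1 * kpPhase α p : ℝ) : ℂ)) * G p) h1.stronglyMeasurable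
  exact h2.measurable

lemma norm_propagator_le (α : ℝ) (G : ℝ × ℝ → ℂ) (t : ℝ) (z : ℝ × ℝ) :
    ‖propagator α G t z‖ ≤ ∫ p, ‖G p‖ := by
  refine (norm_integral_le_integral_norm _).trans_eq ?_
  congr 1
  ext p
  rw [norm_mul, norm_mul, norm_exp_I_mul, norm_exp_I_mul, one_mul, one_mul]

lemma integral_conj_propagator_mul (α : ℝ) (hG : Measurable G) (hGi : Integrable G)
    {F : ℝ → ℝ × ℝ → ℂ} (hF : Measurable (Function.uncurry F))
    (hFi : Integrable (Function.uncurry F)) :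
    ∫ w : ℝ × (ℝ × ℝ), (starRingEnd ℂ) (propagator α G w.1 w.2) * F w.1 w.2 =
      ∫ p, (starRingEnd ℂ) (G p) * spacetimeAdjoint α F p := by
  set e : ℝ × (ℝ × ℝ) → ℝ × ℝ → ℂ := fun w p =>
    Complex.exp (-I * ((w.1 * kpPhase α p : ℝ) : ℂ)) *
      (Complex.exp (-I * (planePairing w.2 p : ℂ)) * F w.1 w.2) with he
  have hem : Measurable (Function.uncurry e) := by
    have := measurable_kpPhase α
    have h1 : Measurable fun u : (ℝ × (ℝ × ℝ)) × (ℝ × ℝ) => F u.1.1 u.1.2 :=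
      hF.comp (f := fun u : (ℝ × (ℝ × ℝ)) × (ℝ × ℝ) => (u.1.1, u.1.2)) (by fun_prop)
    rw [he]
    unfold Function.uncurry planePairing
    fun_prop
  have hen : ∀ w p, ‖e w p‖ = ‖F w.1 w.2‖ := by
    intro w p
    simp only [he]
    rw [norm_mul, norm_mul, norm_exp_neg_I_mul, norm_exp_neg_I_mul, one_mul, one_mul]
  have hK : Integrable (Function.uncurry fun (w : ℝ × (ℝ × ℝ)) (p : ℝ × ℝ) =>
      (starRingEnd ℂ) (G p) * e w p) := by
    have h1 : Integrable (fun u : (ℝ × (ℝ × ℝ)) × (ℝ × ℝ) => Function.uncurry F u.1 * G u.2)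
        (volume.prod volume) := hFi.mul_prod hGi
    refine h1.norm.mono' ?_ (ae_of_all _ fun u => ?_)
    · exact ((Complex.continuous_conj.measurable.comp (hG.comp measurable_snd)).mul
        hem).aestronglyMeasurable
    · change ‖(starRingEnd ℂ) (G u.2) * e u.1 u.2‖ ≤ ‖F u.1.1 u.1.2 * G u.2‖
      rw [norm_mul, hen, RCLike.norm_conj, norm_mul, mul_comm]
  have hs := integral_integral_swap (μ := (volume : Measure (ℝ × (ℝ × ℝ))))
    (ν := (volume : Measure (ℝ × ℝ))) hK
  have hl : ∀ w : ℝ × (ℝ × ℝ), (starRingEnd ℂ) (propagator α G w.1 w.2) * F w.1 w.2 =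
      ∫ p, (starRingEnd ℂ) (G p) * e w p := by
    intro w
    unfold propagator
    rw [← integral_conj, ← integral_mul_const]
    congr 1
    ext p
    simp only [he, map_mul, ← Complex.exp_conj, Complex.conj_I, Complex.conj_ofReal]
    ring
  have hr : ∀ p, (starRingEnd ℂ) (G p) * spacetimeAdjoint α F p =
      ∫ w, (starRingEnd ℂ) (G p) * e w p := by
    intro p
    rw [integral_const_mul]
    congr 1
    have hei : Integrable fun w => e w p :=
      hFi.norm.mono' (hem.comp (by fun_prop : Measurable fun w : ℝ × (ℝ × ℝ) =>
        (w, p))).aestronglyMeasurable (ae_of_all _ fun w => (hen w p).le)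
    have := integral_prod (μ := (volume : Measure ℝ)) (ν := (volume : Measure (ℝ × ℝ)))
      (fun w => e w p) hei
    rw [Measure.volume_eq_prod, this]
    unfold spacetimeAdjoint planeFourier
    congr 1
    ext t
    rw [← integral_const_mul]
  simp_rw [hl, hr]
  exact hs

end Propagator

/-- Truncation of a space-time function to a box and to values of size at least `1 / (n + 1)`. -/
noncomputable def tameTruncation (v : ℝ → ℝ × ℝ → ℂ) (n : ℕ) (t : ℝ) (z : ℝ × ℝ) : ℂ :=
  if |t| ≤ (n : ℝ) + 1 ∧ |z.1| ≤ (n : ℝ) + 1 ∧ |z.2| ≤ (n : ℝ) + 1 ∧ 1 / ((n : ℝ) + 1) ≤ ‖v t z‖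
  then v t z else 0

section Truncation

variable {v : ℝ → ℝ × ℝ → ℂ}

lemma isTame_tameTruncation (hv : Measurable (Function.uncurry v)) {B : ℝ}
    (hB : ∀ t z, ‖v t z‖ ≤ B) (n : ℕ) :
    IsTame (tameTruncation v n) (1 / ((n : ℝ) + 1)) B ((n : ℝ) + 1) := by
  refine ⟨?_, by positivity, by positivity, fun t z h => ?_⟩
  · have h1 : MeasurableSet {w : ℝ × (ℝ × ℝ) | |w.1| ≤ (n : ℝ) + 1 ∧ |w.2.1| ≤ (n : ℝ) + 1 ∧
        |w.2.2| ≤ (n : ℝ) + 1 ∧ 1 / ((n : ℝ) + 1) ≤ ‖Function.uncurry v w‖} := by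
      refine (measurableSet_le (f := fun w : ℝ × (ℝ × ℝ) => |w.1|) (by fun_prop) (by fun_prop)).inter
        ((measurableSet_le (f := fun w : ℝ × (ℝ × ℝ) => |w.2.1|) (by fun_prop) (by fun_prop)).inter
        ((measurableSet_le (f := fun w : ℝ × (ℝ × ℝ) => |w.2.2|) (by fun_prop) (by fun_prop)).inter
        (measurableSet_le (by fun_prop) hv.norm)))
    exact Measurable.ite h1 hv measurable_const
  · unfold tameTruncation at h ⊢
    split_ifs at h ⊢ with hc
    · exact ⟨hc.2.2.2, hB t z, hc.1, hc.2.1, hc.2.2.1⟩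
    · exact absurd rfl h

lemma norm_tameTruncation_mono (v : ℝ → ℝ × ℝ → ℂ) (t : ℝ) (z : ℝ × ℝ) :
    Monotone fun n => ‖tameTruncation v n t z‖ := by
  intro a b hab
  have h : (a : ℝ) ≤ b := by exact_mod_cast hab
  simp only
  unfold tameTruncation
  split_ifs with h1 h2 h2
  · exact le_rfl
  · refine absurd ⟨by linarith, by linarith, by linarith, le_trans ?_ h1.2.2.2⟩ h2
    gcongr
  · simp
  · exact le_rfl

lemma eventually_tameTruncation_eq (v : ℝ → ℝ × ℝ → ℂ) (t : ℝ) (z : ℝ × ℝ) :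
    ∀ᶠ n in Filter.atTop, tameTruncation v n t z = v t z := by
  rcases eq_or_ne (v t z) 0 with h | h
  · refine Filter.Eventually.of_forall fun n => ?_
    unfold tameTruncation
    simp [h]
  · have hp := norm_pos_iff.2 h
    have h1 : ∀ᶠ n : ℕ in Filter.atTop, 1 / ((n : ℝ) + 1) < ‖v t z‖ :=
      tendsto_one_div_add_atTop_nhds_zero_nat.eventually_lt_const hp
    have h2 : ∀ c : ℝ, ∀ᶠ n : ℕ in Filter.atTop, c < (n : ℝ) + 1 := fun c => by
      filter_upwards [tendsto_natCast_atTop_atTop.eventually_gt_atTop c] with n hn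
      linarith
    filter_upwards [h1, h2 |t|, h2 |z.1|, h2 |z.2|] with n a b c d
    unfold tameTruncation
    rw [if_pos ⟨b.le, c.le, d.le, a.le⟩]

lemma conj_mul_dualizer_tameTruncation (θ : ℝ) (v : ℝ → ℝ × ℝ → ℂ) (n : ℕ) (t : ℝ) (z : ℝ × ℝ) :
    (starRingEnd ℂ) (v t z) * dualizer θ (tameTruncation v n) t z =
      (starRingEnd ℂ) (tameTruncation v n t z) * dualizer θ (tameTruncation v n) t z := by
  by_cases h : tameTruncation v n t z = 0
  · simp [dualizer, h]
  · congr 2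
    unfold tameTruncation at h ⊢
    split_ifs at h ⊢
    · rfl
    · exact absurd rfl h

end Truncation

lemma ofReal_rpow_neg_sq (x s : ℝ) (hx : 0 ≤ x) :
    ENNReal.ofReal (x ^ (-(s / 2))) ^ 2 = ENNReal.ofReal (x ^ (-s)) := by
  rw [← ENNReal.ofReal_pow (by positivity), ← Real.rpow_natCast, ← Real.rpow_mul hx]
  congr 2
  push_cast
  ring

lemma le_rpow_of_sq_le {A X : ENNReal} {θ : ℝ} (hθ : 0 < θ) (hA : A ≠ ⊤)
    (h : A ^ 2 ≤ X * A ^ (2 - θ)) : A ≤ X ^ (1 / θ) := by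
  rcases eq_or_ne A 0 with h0 | h0
  · rw [h0]; exact zero_le
  have h1 : A ^ (2 - θ) ≠ 0 := by
    rw [Ne, ENNReal.rpow_eq_zero_iff]
    rintro (⟨h, -⟩ | ⟨h, -⟩)
    · exact h0 h
    · exact hA h
  have h2 : A ^ (2 - θ) ≠ ⊤ := ENNReal.rpow_ne_top_of_ne_zero h0 hA
  have h3 : A ^ 2 = A ^ θ * A ^ (2 - θ) := by
    rw [← ENNReal.rpow_add _ _ h0 hA, ← ENNReal.rpow_natCast]
    congr 1
    push_cast
    ring
  rw [h3, ENNReal.mul_le_mul_iff_left h1 h2] at h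
  calc A = (A ^ θ) ^ (1 / θ) := by
        rw [← ENNReal.rpow_mul, mul_one_div_cancel hθ.ne', ENNReal.rpow_one]
    _ ≤ X ^ (1 / θ) := by gcongr

section Estimates

variable {α θ : ℝ} {g : ℝ × ℝ → ℂ}

lemma lintegral_tameTruncation_le (hα : 1 < α) (hθ : 0 < θ) (hθ1 : θ < 1) (hg : Measurable g)
    (hGi : Integrable fun p : ℝ × ℝ => ((|p.1| ^ (-((1 - α / 2) * θ / 2)) : ℝ) : ℂ) * g p) (n : ℕ) :
    ∫⁻ t, ENNReal.ofReal ((∫ x, ‖tameTruncation (propagator α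
        fun p => ((|p.1| ^ (-((1 - α / 2) * θ / 2)) : ℝ) : ℂ) * g p) n t x‖ ^ (2 / (1 - θ))) ^
          ((1 - θ) / θ)) ≤ (dualConst α θ * ∫⁻ p, ‖g p‖ₑ ^ 2) ^ (1 / θ) := by
  set G : ℝ × ℝ → ℂ := fun p => ((|p.1| ^ (-((1 - α / 2) * θ / 2)) : ℝ) : ℂ) * g p with hG
  have hGm : Measurable G := by
    rw [hG]
    fun_prop
  set w := propagator α G with hw
  have hwm : Measurable (Function.uncurry w) := measurable_propagator α hGm
  set v := tameTruncation w n with hv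
  have hvt := isTame_tameTruncation hwm (norm_propagator_le α G) n
  rw [← hv] at hvt
  set F := dualizer θ v with hF
  have hFm : Measurable (Function.uncurry F) := measurable_dualizer hvt
  have hFi : Integrable (Function.uncurry F) := integrable_dualizer hθ hθ1 hvt
  have hFs : ∀ t, IsSimpleLike (F t) := isSimpleLike_dualizer hθ hθ1 hvt
  set R : ℝ × (ℝ × ℝ) → ℝ := fun u => ‖v u.1 u.2‖ ^ (2 / (1 - θ)) *
    (∫ x, ‖v u.1 x‖ ^ (2 / (1 - θ))) ^ ((1 - θ) / θ - 1) with hR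
  have hR0 : ∀ u, 0 ≤ R u := fun u =>
    mul_nonneg (by positivity) (Real.rpow_nonneg (mass_nonneg _ _ _) _)
  have hRm : Measurable R := (hvt.1.norm.pow_const _).mul
    (((measurable_mass hvt _).comp measurable_fst).pow_const _)
  have hwF : ∀ u : ℝ × (ℝ × ℝ), (starRingEnd ℂ) (w u.1 u.2) * F u.1 u.2 = ((R u : ℝ) : ℂ) := by
    intro u
    rw [hF, hv, conj_mul_dualizer_tameTruncation, ← hv, conj_mul_dualizer hθ hθ1]
  have hRi : Integrable R := by
    refine (hFi.norm.const_mul (∫ p, ‖G p‖)).mono' hRm.aestronglyMeasurable (ae_of_all _ fun u => ?_)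
    have h1 : ‖R u‖ = ‖w u.1 u.2‖ * ‖F u.1 u.2‖ := by
      rw [← RCLike.norm_conj (w u.1 u.2), ← norm_mul, hwF, Complex.norm_real]
    rw [h1]
    exact mul_le_mul_of_nonneg_right (norm_propagator_le α G u.1 u.2) (norm_nonneg _)
  set A := ∫⁻ t, ENNReal.ofReal ((∫ x, ‖v t x‖ ^ (2 / (1 - θ))) ^ ((1 - θ) / θ)) with hA
  have hAR : A = ENNReal.ofReal (∫ u, R u) := by
    rw [ofReal_integral_eq_lintegral_ofReal hRi (ae_of_all _ hR0), Measure.volume_eq_prod,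
      lintegral_prod _ (by fun_prop), hA]
    refine lintegral_congr fun t => ?_
    have hi : Integrable fun x => ‖v t x‖ ^ (2 / (1 - θ)) :=
      (hvt.isSimpleLike t).integrable_rpow (div_pos two_pos (by linarith))
    rw [← ofReal_integral_eq_lintegral_ofReal (f := fun z => R (t, z))
      (hi.mul_const ((∫ x, ‖v t x‖ ^ (2 / (1 - θ))) ^ ((1 - θ) / θ - 1)))
      (ae_of_all _ fun z => hR0 _)]
    congr 1
    simp only [hR]
    rw [integral_mul_const, mass_mul_rpow hθ hθ1]
  have hAtop : A ≠ ⊤ := by rw [hAR]; exact ENNReal.ofReal_ne_top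
  have hAH : A = ‖∫ p, (starRingEnd ℂ) (G p) * spacetimeAdjoint α F p‖ₑ := by
    rw [← integral_conj_propagator_mul α hGm hGi hFm hFi]
    simp_rw [← hw, hwF]
    rw [integral_complex_ofReal, ← ofReal_norm, Complex.norm_real, Real.norm_eq_abs,
      abs_of_nonneg (integral_nonneg hR0), hAR]
  have hdual := lintegral_spacetimeAdjoint_le hα hθ hθ1 hFm hFi hFs
  have hAe : ∫⁻ t, ENNReal.ofReal (sliceNorm θ F t) ^ (2 / (2 - θ)) = A :=
    lintegral_congr fun t => sliceNorm_dualizer hθ hθ1 v t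
  rw [hAe] at hdual
  have hHm := measurable_spacetimeAdjoint α hFm
  have hAle : A ≤ (∫⁻ p, ‖g p‖ₑ ^ 2) ^ (1 / 2 : ℝ) *
      (dualConst α θ * A ^ (2 - θ)) ^ (1 / 2 : ℝ) := by
    calc A ≤ ∫⁻ p, ‖(starRingEnd ℂ) (G p) * spacetimeAdjoint α F p‖ₑ := by
          rw [hAH]; exact enorm_integral_le_lintegral_enorm _
      _ = ∫⁻ p, ‖g p‖ₑ * (ENNReal.ofReal (|p.1| ^ (-((1 - α / 2) * θ / 2))) *
            ‖spacetimeAdjoint α F p‖ₑ) := by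
          refine lintegral_congr fun p => ?_
          rw [enorm_mul, ← ofReal_norm ((starRingEnd ℂ) (G p)), RCLike.norm_conj, ofReal_norm, hG,
            enorm_mul, ← ofReal_norm (Complex.ofReal _), Complex.norm_real, Real.norm_eq_abs,
            abs_of_nonneg (by positivity)]
          ring
      _ ≤ _ := lintegral_enorm_mul_le (by fun_prop) (by fun_prop)
      _ ≤ _ := by
          gcongr
          refine le_trans (lintegral_mono fun p => le_of_eq ?_) hdual
          rw [mul_pow, ofReal_rpow_neg_sq _ _ (abs_nonneg _)]
  refine le_rpow_of_sq_le hθ hAtop ?_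
  have h2 : ∀ x : ENNReal, (x ^ (1 / 2 : ℝ)) ^ 2 = x := fun x => by
    rw [← ENNReal.rpow_natCast, ← ENNReal.rpow_mul]
    norm_num
  calc A ^ 2 ≤ ((∫⁻ p, ‖g p‖ₑ ^ 2) ^ (1 / 2 : ℝ) * (dualConst α θ * A ^ (2 - θ)) ^ (1 / 2 : ℝ)) ^ 2 := by
        gcongr
    _ = _ := by rw [mul_pow, h2, h2]; ring

lemma lintegral_propagator_le (hα : 1 < α) (hθ : 0 < θ) (hθ1 : θ < 1) (hg : Measurable g)
    (hGi : Integrable fun p : ℝ × ℝ => ((|p.1| ^ (-((1 - α / 2) * θ / 2)) : ℝ) : ℂ) * g p) :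
    ∫⁻ t, (∫⁻ x, ENNReal.ofReal (‖propagator α
        (fun p => ((|p.1| ^ (-((1 - α / 2) * θ / 2)) : ℝ) : ℂ) * g p) t x‖ ^ (2 / (1 - θ)))) ^
          ((1 - θ) / θ) ≤ (dualConst α θ * ∫⁻ p, ‖g p‖ₑ ^ 2) ^ (1 / θ) := by
  set G : ℝ × ℝ → ℂ := fun p => ((|p.1| ^ (-((1 - α / 2) * θ / 2)) : ℝ) : ℂ) * g p with hG
  have hGm : Measurable G := by
    rw [hG]
    fun_prop
  set w := propagator α G with hw
  have hwm : Measurable (Function.uncurry w) := measurable_propagator α hGm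
  have hs : 0 < 2 / (1 - θ) := div_pos two_pos (by linarith)
  have hb : 0 < (1 - θ) / θ := div_pos (by linarith) hθ
  have hvt := fun n => isTame_tameTruncation hwm (norm_propagator_le α G) n
  refine lintegral_le_of_tendsto_of_le (u := fun n t => ENNReal.ofReal
    ((∫ x, ‖tameTruncation w n t x‖ ^ (2 / (1 - θ))) ^ ((1 - θ) / θ))) (fun n => ?_)
    (ae_of_all _ fun t => ?_) (lintegral_tameTruncation_le hα hθ hθ1 hg hGi)
  · exact ((measurable_mass (hvt n) _).pow_const _).ennreal_ofReal.aemeasurable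
  · have e : ∀ n, ENNReal.ofReal ((∫ x, ‖tameTruncation w n t x‖ ^ (2 / (1 - θ))) ^ ((1 - θ) / θ)) =
        (∫⁻ x, ENNReal.ofReal (‖tameTruncation w n t x‖ ^ (2 / (1 - θ)))) ^ ((1 - θ) / θ) := by
      intro n
      rw [← ENNReal.ofReal_rpow_of_nonneg (mass_nonneg _ _ _) hb.le,
        ofReal_integral_eq_lintegral_ofReal (((hvt n).isSimpleLike t).integrable_rpow hs)
          (ae_of_all _ fun x => by positivity)]
    simp_rw [e]
    refine ((ENNReal.continuous_rpow_const).tendsto _).comp ?_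
    refine lintegral_tendsto_of_tendsto_of_monotone (fun n => ?_) (ae_of_all _ fun x => ?_)
      (ae_of_all _ fun x => ?_)
    · have := (hvt n).measurable_slice t
      fun_prop
    · intro a b hab
      refine ENNReal.ofReal_le_ofReal ?_
      exact Real.rpow_le_rpow (norm_nonneg _) (norm_tameTruncation_mono w t x hab) hs.le
    · refine tendsto_const_nhds.congr' ?_
      filter_upwards [eventually_tameTruncation_eq w t x] with n hn
      rw [hn]

end Estimates

lemma integral_le_toReal_of_lintegral_le {X : Type*} [MeasurableSpace X] {μ : Measure X}
    {f : X → ℝ} (hf : ∀ x, 0 ≤ f x) (hfm : AEStronglyMeasurable f μ) {C : ENNReal} (hC : C ≠ ⊤)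
    (h : ∫⁻ x, ENNReal.ofReal (f x) ∂μ ≤ C) : ∫ x, f x ∂μ ≤ C.toReal := by
  rw [integral_eq_lintegral_of_nonneg_ae (ae_of_all _ hf) hfm]
  exact ENNReal.toReal_mono hC h

lemma propagator_eq_zero_of_not_integrable (α : ℝ) {G : ℝ × ℝ → ℂ} (hG : Measurable G)
    (hGi : ¬ Integrable G) (t : ℝ) (z : ℝ × ℝ) : propagator α G t z = 0 := by
  refine integral_undef fun h => hGi ?_
  refine h.norm.mono' hG.aestronglyMeasurable (ae_of_all _ fun p => ?_)
  rw [norm_mul, norm_mul, norm_exp_I_mul, norm_exp_I_mul, one_mul, one_mul]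

lemma integral_propagator_rpow_le {α θ : ℝ} {g : ℝ × ℝ → ℂ} (hα : 1 < α) (hθ : 0 < θ) (hθ1 : θ < 1)
    (hg : Measurable g) {N : ℝ} (hN : 0 ≤ N) (hgN : ∫⁻ p, ‖g p‖ₑ ^ 2 ≤ ENNReal.ofReal N) :
    (∫ t, (∫ x, ‖propagator α (fun p => ((|p.1| ^ (-((1 - α / 2) * θ / 2)) : ℝ) : ℂ) * g p) t x‖ ^
      (2 / (1 - θ))) ^ ((1 - θ) / θ)) ^ (θ / 2) ≤ ((dualConst α θ).toReal * N) ^ (1 / 2 : ℝ) := by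
  set G : ℝ × ℝ → ℂ := fun p => ((|p.1| ^ (-((1 - α / 2) * θ / 2)) : ℝ) : ℂ) * g p with hG
  have hGm : Measurable G := by
    rw [hG]
    fun_prop
  have hs : 0 < 2 / (1 - θ) := div_pos two_pos (by linarith)
  have hb : 0 < (1 - θ) / θ := div_pos (by linarith) hθ
  by_cases hGi : Integrable G
  · have hwm : Measurable (Function.uncurry (propagator α G)) := measurable_propagator α hGm
    have hm : Measurable fun t => ∫ x, ‖propagator α G t x‖ ^ (2 / (1 - θ)) := by
      have h : StronglyMeasurable
          (Function.uncurry fun t x => ‖propagator α G t x‖ ^ (2 / (1 - θ))) :=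
        (hwm.norm.pow_const _).stronglyMeasurable
      exact (h.integral_prod_right (ν := volume)).measurable
    have hD : dualConst α θ ≠ ⊤ := ENNReal.mul_ne_top ENNReal.ofReal_ne_top ENNReal.ofReal_ne_top
    have hDN : dualConst α θ * ENNReal.ofReal N ≠ ⊤ := ENNReal.mul_ne_top hD ENNReal.ofReal_ne_top
    have h1 : ∫ t, (∫ x, ‖propagator α G t x‖ ^ (2 / (1 - θ))) ^ ((1 - θ) / θ) ≤
        ((dualConst α θ * ENNReal.ofReal N) ^ (1 / θ)).toReal := by
      refine integral_le_toReal_of_lintegral_le (fun t => Real.rpow_nonneg (mass_nonneg _ _ _) _)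
        (hm.pow_const _).aestronglyMeasurable
        (ENNReal.rpow_ne_top_of_nonneg (by positivity) hDN) ?_
      refine le_trans (lintegral_mono fun t => ?_)
        ((lintegral_propagator_le hα hθ hθ1 hg hGi).trans (by gcongr))
      rw [← ENNReal.ofReal_rpow_of_nonneg (mass_nonneg _ _ _) hb.le]
      refine ENNReal.rpow_le_rpow ?_ hb.le
      have hx : Measurable fun x => ‖propagator α G t x‖ ^ (2 / (1 - θ)) :=
        (hwm.comp (by fun_prop : Measurable fun z : ℝ × ℝ => (t, z))).norm.pow_const _
      rw [integral_eq_lintegral_of_nonneg_ae (ae_of_all _ fun x => by positivity)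
        hx.aestronglyMeasurable]
      exact ENNReal.ofReal_toReal_le
    rw [← ENNReal.toReal_rpow, ENNReal.toReal_mul, ENNReal.toReal_ofReal hN] at h1
    have h0 : 0 ≤ (dualConst α θ).toReal * N := mul_nonneg ENNReal.toReal_nonneg hN
    refine (Real.rpow_le_rpow (integral_nonneg fun t => Real.rpow_nonneg (mass_nonneg _ _ _) _) h1
      (by positivity)).trans_eq ?_
    rw [← Real.rpow_mul h0]
    congr 1
    field_simp
  · simp only [propagator_eq_zero_of_not_integrable α hGm hGi, norm_zero, Real.zero_rpow hs.ne',
      integral_zero, Real.zero_rpow hb.ne']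
    rw [Real.zero_rpow (by positivity)]
    exact Real.rpow_nonneg (mul_nonneg ENNReal.toReal_nonneg hN) _

lemma lintegral_planeFourier_schwartz_le (u : SchwartzMap (ℝ × ℝ) ℂ) :
    ∫⁻ p, ‖planeFourier u p‖ₑ ^ 2 ≤ ENNReal.ofReal (4 * π ^ 2 * ∫ x, ‖u x‖ ^ (2 : ℝ)) := by
  refine (lintegral_planeFourier_sq_le u.continuous.measurable u.integrable).trans_eq ?_
  have h2 : Integrable fun x => ‖u x‖ ^ (2 : ℝ) := by
    have := (u.memLp 2 (volume : Measure (ℝ × ℝ))).integrable_norm_rpow two_ne_zero ENNReal.ofNat_ne_top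
    simpa using this
  rw [ENNReal.ofReal_mul (p := 4 * π ^ 2) (by positivity), ofReal_integral_eq_lintegral_ofReal h2
    (ae_of_all _ fun x => by positivity)]
  congr 1
  refine lintegral_congr fun x => ?_
  rw [← ofReal_norm, ← ENNReal.ofReal_pow (norm_nonneg _), Real.rpow_two]

/-- Strichartz estimate for the linear dispersion-generalised KP-II group:
for `4/3 < α ≤ 6`, `2 < q < ∞`, `1/r + 1/q = 1/2` (i.e. `r = 2q/(q-2)`),
`γ = (1 - 2/r)(1/2 - α/4)`,
`‖ |D_x|^{-γ} U_α(t) u₀ ‖_{L^q_t L^r_{xy}} ≤ C ‖u₀‖_{L²}`. -/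
theorem strichartz_estimate (α q : ℝ) (hα1 : 4 / 3 < α) (hα2 : α ≤ 6)
    (hq : 2 < q) :
    ∃ C > 0, ∀ u₀ : SchwartzMap (ℝ × ℝ) ℂ,
      (∫ t : ℝ,
          (∫ z : ℝ × ℝ,
            ‖∫ p : ℝ × ℝ,
                Complex.exp (Complex.I * ((z.1 * p.1 + z.2 * p.2 : ℝ) : ℂ)) *
                ((|p.1| ^ (-((1 - 2 / (2 * q / (q - 2))) * (1 / 2 - α / 4))) : ℝ) : ℂ) *
                Complex.exp (Complex.I *
                  ((t * (p.1 * |p.1| ^ α - p.2 ^ 2 / p.1) : ℝ) : ℂ)) *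
                (∫ w : ℝ × ℝ,
                  Complex.exp (-Complex.I * ((w.1 * p.1 + w.2 * p.2 : ℝ) : ℂ)) * u₀ w)‖
              ^ (2 * q / (q - 2))) ^ (q / (2 * q / (q - 2)))) ^ (1 / q)
        ≤ C * (∫ w : ℝ × ℝ, ‖u₀ w‖ ^ (2 : ℝ)) ^ ((1 : ℝ) / 2) := by
  have hq0 : q ≠ 0 := by linarith
  have hq2 : q - 2 ≠ 0 := by linarith
  have hθ : 0 < 2 / q := div_pos two_pos (by linarith)
  have hθ1 : 2 / q < 1 := by rw [div_lt_one (by linarith)]; exact hq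
  have e0 : 1 - 2 / q = (q - 2) / q := by field_simp
  have e1 : 2 * q / (q - 2) = 2 / (1 - 2 / q) := by rw [e0]; field_simp
  have e2 : q / (2 * q / (q - 2)) = (1 - 2 / q) / (2 / q) := by rw [e0]; field_simp
  have e3 : 1 / q = 2 / q / 2 := by field_simp
  have e4 : (1 - 2 / (2 * q / (q - 2))) * (1 / 2 - α / 4) = (1 - α / 2) * (2 / q) / 2 := by
    field_simp
    ring
  refine ⟨((dualConst α (2 / q)).toReal * (4 * π ^ 2)) ^ (1 / 2 : ℝ) + 1, by positivity, fun u₀ => ?_⟩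
  have hu : 0 ≤ ∫ w : ℝ × ℝ, ‖u₀ w‖ ^ (2 : ℝ) := integral_nonneg fun _ => by positivity
  have h := integral_propagator_rpow_le (by linarith : 1 < α) hθ hθ1
    (measurable_planeFourier u₀.continuous.measurable) (by positivity)
    (lintegral_planeFourier_schwartz_le u₀)
  have hw : ∀ (t : ℝ) (z : ℝ × ℝ), ∫ p : ℝ × ℝ,
      Complex.exp (Complex.I * ((z.1 * p.1 + z.2 * p.2 : ℝ) : ℂ)) *
        ((|p.1| ^ (-((1 - α / 2) * (2 / q) / 2)) : ℝ) : ℂ) *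
        Complex.exp (Complex.I * ((t * (p.1 * |p.1| ^ α - p.2 ^ 2 / p.1) : ℝ) : ℂ)) *
        (∫ w : ℝ × ℝ, Complex.exp (-Complex.I * ((w.1 * p.1 + w.2 * p.2 : ℝ) : ℂ)) * u₀ w) =
      propagator α (fun p => ((|p.1| ^ (-((1 - α / 2) * (2 / q) / 2)) : ℝ) : ℂ) *
        planeFourier u₀ p) t z := by
    intro t z
    unfold propagator planeFourier planePairing kpPhase
    congr 1
    ext p
    ring
  rw [e4, e2, e3, e1]
  simp_rw [hw]
  refine h.trans ?_
  rw [← mul_assoc, Real.mul_rpow (by positivity) hu]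
  refine mul_le_mul_of_nonneg_right ?_ (by positivity)
  linarith
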